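/- arXiv:2507.20416 — 2 statements merged into one kernel-verified Lean document; each statement's English description precedes it below -/
import Mathlib

section
/- Let α = (α_1, …, α_6) be a 6-tuple of pairwise independent irrational numbers with k(α) = 3. Then there exists T > 1 such that for every t_0 ≥ T and every i ≥ 0, it is not the case that simultaneously v_α(t_{i+2}) = v_α(t_i), v_α(t_{i+1}) ≠ v_α(t_i), and v_α(t_{i+3}) ∉ {v_α(t_i), v_α(t_{i+1})}, where {t_m} is the sequence of moments of permutation changes starting from t_0. (Consequently the sequence {v_α(t_i)} is eventually periodic with period 3.) -/
/-- Distance from `x` to the nearest integer. -/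
noncomputable def distToInt (x : ℝ) : ℝ := |x - round x|

/-- The irrationality measure function `ψ_α(t) = min_{1 ≤ q ≤ t} ‖qα‖`. -/
noncomputable def psi (α : ℝ) (t : ℝ) : ℝ :=
  sInf ((fun q : ℤ => distToInt ((q : ℝ) * α)) '' {q : ℤ | 1 ≤ q ∧ (q : ℝ) ≤ t})

/-- An `n`-tuple is pairwise independent if eventually all the values
`ψ_{α_i}(t)` are pairwise distinct. -/
def PairwiseIndependent {n : ℕ} (α : Fin n → ℝ) : Prop :=
  ∃ T : ℝ, 0 ≤ T ∧ ∀ t : ℝ, T ≤ t → ∀ i j : Fin n, i ≠ j → psi (α i) t ≠ psi (α j) t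

/-- `v : Fin n → Fin n` is the order vector of `α` at time `t`:
`ψ_{α_{v 0}}(t) > ψ_{α_{v 1}}(t) > … > ψ_{α_{v (n-1)}}(t)`. -/
def IsOrderVec {n : ℕ} (α : Fin n → ℝ) (t : ℝ) (v : Fin n → Fin n) : Prop :=
  Function.Bijective v ∧
    ∀ p q : Fin n, p < q → psi (α (v p)) t > psi (α (v q)) t

/-- The order vector `v` occurs at arbitrarily large times. -/
def OccursInfinitely {n : ℕ} (α : Fin n → ℝ) (v : Fin n → Fin n) : Prop :=
  ∀ T : ℝ, ∃ t : ℝ, T < t ∧ IsOrderVec α t v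

/-- `k(α)`: the number of distinct order vectors occurring for arbitrarily large `t`. -/
noncomputable def kAlpha {n : ℕ} (α : Fin n → ℝ) : ℕ :=
  Nat.card {v : Fin n → Fin n | OccursInfinitely α v}

/-- The relative order of the functions `ψ_{α_i}` is the same at times `t` and `t'`
(i.e. the order vectors coincide). -/
def SameOrder {n : ℕ} (α : Fin n → ℝ) (t t' : ℝ) : Prop :=
  ∀ i j : Fin n, (psi (α i) t < psi (α j) t ↔ psi (α i) t' < psi (α j) t')

/-- `ts` is a sequence of moments of permutation changes:
`ts (i+1) = min { t > ts i : v_α(t) ≠ v_α(ts i) }`. -/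
def IsChangeSeq {n : ℕ} (α : Fin n → ℝ) (ts : ℕ → ℝ) : Prop :=
  ∀ i : ℕ, IsLeast {t : ℝ | ts i < t ∧ ¬ SameOrder α (ts i) t} (ts (i + 1))

/-- The set of positions `(j,l)`, `1 ≤ j ≤ l ≤ k` (here `0`-based). -/
def PairIdx (k : ℕ) := {p : Fin k × Fin k // p.1 ≤ p.2}

/-- Construct a position from `0`-based indices `j ≤ l < k`. -/
def mkPos {k : ℕ} (j l : ℕ) (hj : j ≤ l) (hl : l < k) : PairIdx k :=
  ⟨(⟨j, lt_of_le_of_lt hj hl⟩, ⟨l, hl⟩), Fin.mk_le_mk.mpr hj⟩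

/-- The position permutation underlying `π`: one has `π(u) = u ∘ tau`.
In `1`-based notation: `tau (i,i) = (i+1,i+1)` for `i < k`, `tau (k,k) = (1,1)`,
`tau (i,k) = (1,i+1)` for `i < k`, and `tau (i,j) = (i+1,j+1)` otherwise. -/
def tau {k : ℕ} (p : PairIdx k) : PairIdx k :=
  if h2 : p.1.2.val = k - 1 then
    if h1 : p.1.1.val = k - 1 then
      ⟨(⟨0, by have := p.1.2.isLt; omega⟩, ⟨0, by have := p.1.2.isLt; omega⟩), le_refl _⟩
    else
      ⟨(⟨0, by have := p.1.2.isLt; omega⟩,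
        ⟨p.1.1.val + 1, by have := p.1.1.isLt; omega⟩),
       Fin.mk_le_mk.mpr (by omega)⟩
  else
    ⟨(⟨p.1.1.val + 1, by have h := p.1.2.isLt; have h' : p.1.1.val ≤ p.1.2.val := p.2; omega⟩,
      ⟨p.1.2.val + 1, by have h := p.1.2.isLt; omega⟩),
     Fin.mk_le_mk.mpr (by have h' : p.1.1.val ≤ p.1.2.val := p.2; omega)⟩

/-- The action of `π` on vectors indexed by positions: `π(u) = u ∘ tau`. -/
def piMap {k : ℕ} {X : Type*} (u : PairIdx k → X) : PairIdx k → X :=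
  fun p => u (tau p)

/-- The (`0`-based) linear position of the pair `(j,l)` in the special enumeration
`u_{1,1}, u_{1,k}, u_{1,k-1}, …, u_{1,2}, u_{2,2}, u_{2,k}, …, u_{k,k}`. -/
def posIdx {k : ℕ} (p : PairIdx k) : ℕ :=
  (p.1.1.val * k - p.1.1.val * (p.1.1.val - 1) / 2) +
    (if p.1.2.val = p.1.1.val then 0 else k - p.1.2.val)

/-- `v : PairIdx k → Fin n` is the order vector of `α` at time `t`, written in the
special pair enumeration: the function at position `p` is larger than the one at
position `q` whenever `p` precedes `q` in the enumeration. -/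
def IsOrderVecP {n k : ℕ} (α : Fin n → ℝ) (t : ℝ) (v : PairIdx k → Fin n) : Prop :=
  Function.Bijective v ∧
    ∀ p q : PairIdx k, posIdx p < posIdx q → psi (α (v p)) t > psi (α (v q)) t

/-- Denominator `q_m` of the `m`-th convergent of the continued fraction of `α`. -/
noncomputable def cfDen (α : ℝ) (m : ℕ) : ℝ := (GenContFract.of α).dens m

/-- The orbit equivalence relation of the map `tau` on positions. -/
def orbitSetoid (k : ℕ) : Setoid (PairIdx k) where
  r p q := ∃ a b : ℕ, (fun x : PairIdx k => tau x)^[a] p = (fun x : PairIdx k => tau x)^[b] q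
  iseqv := by
    constructor
    · exact fun p => ⟨0, 0, rfl⟩
    · rintro p q ⟨a, b, h⟩; exact ⟨b, a, h.symm⟩
    · rintro p q r ⟨a, b, h1⟩ ⟨c, d, h2⟩
      refine ⟨c + a, b + d, ?_⟩
      rw [Function.iterate_add_apply, h1, ← Function.iterate_add_apply,
        Nat.add_comm c b, Function.iterate_add_apply, h2, ← Function.iterate_add_apply]


/-- The signed error of the best integer approximation to `n * α`. -/
noncomputable def err (α : ℝ) (n : ℕ) : ℝ := (n : ℝ) * α - round ((n : ℝ) * α)

/-- `n` is a best approximation denominator of `α`, i.e. a point where `psi α` drops. -/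
def IsRecord (α : ℝ) (n : ℕ) : Prop :=
  1 ≤ n ∧ ∀ m : ℕ, 1 ≤ m → m < n → |err α n| < |err α m|

/-- `x < y` are consecutive best approximation denominators of `α`. -/
def IsConsec (α : ℝ) (x y : ℕ) : Prop :=
  IsRecord α x ∧ IsRecord α y ∧ x < y ∧ ∀ z : ℕ, x < z → z < y → ¬ IsRecord α z

/-- `r` is the last best approximation denominator of `α` not exceeding `t`. -/
def IsLastRecord (α : ℝ) (t r : ℕ) : Prop :=
  IsRecord α r ∧ r ≤ t ∧ ∀ z : ℕ, r < z → z ≤ t → ¬ IsRecord α z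

lemma err_ne_zero {α : ℝ} (h : Irrational α) {n : ℕ} (hn : 1 ≤ n) : err α n ≠ 0 := by
  have h1 : Irrational ((n : ℝ) * α) := h.natCast_mul (by omega)
  intro h0
  exact h1.ne_int _ (sub_eq_zero.1 h0)

lemma psi_le {α : ℝ} {m : ℕ} {t : ℝ} (hm : 1 ≤ m) (hmt : (m : ℝ) ≤ t) :
    psi α t ≤ |err α m| := by
  refine csInf_le ⟨0, ?_⟩ ⟨(m : ℤ), ⟨by exact_mod_cast hm, by exact_mod_cast hmt⟩, ?_⟩
  · rintro _ ⟨q, -, rfl⟩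
    exact abs_nonneg _
  · simp [distToInt, err]

lemma psi_mem {α t : ℝ} (ht : 1 ≤ t) :
    ∃ m : ℕ, 1 ≤ m ∧ (m : ℝ) ≤ t ∧ psi α t = |err α m| := by
  have hfin : {q : ℤ | 1 ≤ q ∧ (q : ℝ) ≤ t}.Finite :=
    (Set.finite_Icc 1 ⌊t⌋).subset fun q hq => ⟨hq.1, Int.le_floor.2 hq.2⟩
  have hne : {q : ℤ | 1 ≤ q ∧ (q : ℝ) ≤ t}.Nonempty := ⟨1, le_refl _, by simpa using ht⟩
  obtain ⟨q, ⟨hq1, hq2⟩, hq⟩ := (hne.image fun q : ℤ => distToInt ((q : ℝ) * α)).csInf_mem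
    (hfin.image _)
  obtain ⟨m, rfl⟩ := Int.eq_ofNat_of_zero_le (show 0 ≤ q by omega)
  exact ⟨m, by omega, by exact_mod_cast hq2, by rw [psi, ← hq]; simp [distToInt, err]⟩

lemma exists_isLastRecord (α : ℝ) {t : ℕ} (ht : 1 ≤ t) :
    ∃ r, IsLastRecord α t r ∧ psi α t = |err α r| := by
  classical
  have hex : ∃ m : ℕ, 1 ≤ m ∧ m ≤ t ∧ psi α t = |err α m| := by
    obtain ⟨m, h1, h2, h3⟩ := psi_mem (α := α) (t := t) (by exact_mod_cast ht)
    exact ⟨m, h1, by exact_mod_cast h2, h3⟩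
  obtain ⟨h1, h2, h3⟩ := Nat.find_spec hex
  have hmin := fun m => Nat.find_min hex (m := m)
  generalize Nat.find hex = r at h1 h2 h3 hmin
  have hle : ∀ m : ℕ, 1 ≤ m → m ≤ t → |err α r| ≤ |err α m| := fun m hm hmt =>
    h3 ▸ psi_le hm (by exact_mod_cast hmt)
  refine ⟨r, ⟨⟨h1, fun m hm hmr => lt_of_le_of_ne (hle m hm (by omega)) fun h => ?_⟩, h2,
    fun z hz hzt hrec => ?_⟩, h3⟩
  · exact hmin m hmr ⟨hm, by omega, h3.trans h⟩
  · exact absurd (hrec.2 r h1 hz) (not_lt.2 (hle z (by omega) hzt))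

lemma IsLastRecord.psi_eq {α : ℝ} {t r : ℕ} (h : IsLastRecord α t r) : psi α t = |err α r| := by
  obtain ⟨s, hs, hpsi⟩ := exists_isLastRecord α (h.1.1.trans h.2.1)
  rcases lt_trichotomy r s with hlt | rfl | hlt
  · exact absurd hs.1 (h.2.2 s hlt hs.2.1)
  · exact hpsi
  · exact absurd h.1 (hs.2.2 r hlt h.2.1)

lemma IsRecord.psi_eq {α : ℝ} {r : ℕ} (h : IsRecord α r) : psi α r = |err α r| :=
  IsLastRecord.psi_eq ⟨h, le_rfl, fun _ h1 h2 => absurd h1 (by omega)⟩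

lemma IsConsec.isLastRecord {α : ℝ} {x y t : ℕ} (h : IsConsec α x y) (hx : x ≤ t) (hy : t < y) :
    IsLastRecord α t x :=
  ⟨h.1, hx, fun z h1 h2 => h.2.2.2 z h1 (by omega)⟩

lemma psi_pos {α : ℝ} (h : Irrational α) {t : ℕ} (ht : 1 ≤ t) : 0 < psi α t := by
  obtain ⟨r, hr, hpsi⟩ := exists_isLastRecord α ht
  exact hpsi ▸ abs_pos.2 (err_ne_zero h hr.1.1)

lemma psi_anti {α : ℝ} {s t : ℝ} (hs : 1 ≤ s) (hst : s ≤ t) : psi α t ≤ psi α s := by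
  obtain ⟨m, h1, h2, h3⟩ := psi_mem (α := α) hs
  exact h3 ▸ psi_le h1 (h2.trans hst)

lemma psi_floor {α t : ℝ} (ht : 0 ≤ t) : psi α (⌊t⌋₊ : ℕ) = psi α t := by
  unfold psi
  congr 2
  ext q
  simp only [Set.mem_ofPred_eq, and_congr_right_iff]
  intro hq
  obtain ⟨m, rfl⟩ := Int.eq_ofNat_of_zero_le (show 0 ≤ q by omega)
  simpa using Nat.le_floor_iff ht

lemma psi_le_inv (α : ℝ) {t : ℕ} (ht : 1 ≤ t) : psi α t ≤ 1 / (t + 1) := by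
  obtain ⟨k, hk0, hk, hle⟩ := Real.exists_nat_abs_mul_sub_round_le α (n := t) (by omega)
  exact (psi_le hk0 (by exact_mod_cast hk)).trans hle

lemma isRecord_of_psi_lt {α : ℝ} {n : ℕ} (hn : 1 ≤ n) (h : psi α (n + 1 : ℕ) < psi α n) :
    IsRecord α (n + 1) := by
  obtain ⟨r, hr, hpsi⟩ := exists_isLastRecord α (t := n + 1) (by omega)
  rcases Nat.lt_or_ge n r with hlt | hle
  · obtain rfl : r = n + 1 := by have := hr.2.1; omega
    exact hr.1
  · exact absurd (psi_le hr.1.1 (by exact_mod_cast hle)) (not_le.2 (hpsi ▸ h))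

lemma exists_isRecord_gt {α : ℝ} (h : Irrational α) (t : ℕ) : ∃ r, t < r ∧ IsRecord α r := by
  obtain ⟨n, hn⟩ := exists_nat_one_div_lt (psi_pos h (t := t + 1) (by omega))
  obtain ⟨r, hr, hpsi⟩ := exists_isLastRecord α (t := n + t + 1) (by omega)
  refine ⟨r, ?_, hr.1⟩
  by_contra! hle
  have h1 : psi α (t + 1 : ℕ) ≤ |err α r| := psi_le hr.1.1 (by exact_mod_cast (by omega))
  have h2 := psi_le_inv α (t := n + t + 1) (by omega)
  have h3 : (1 : ℝ) / ((n + t + 1 : ℕ) + 1) ≤ 1 / (n + 1) := by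
    apply one_div_le_one_div_of_le
    · positivity
    · push_cast; linarith [(Nat.cast_nonneg t : (0 : ℝ) ≤ t)]
  linarith

lemma exists_first_isRecord {α : ℝ} {t s : ℕ} (hs : IsRecord α s) (hts : t < s) :
    ∃ r, IsRecord α r ∧ t < r ∧ r ≤ s ∧ ∀ z, t < z → z < r → ¬ IsRecord α z := by
  classical
  have hex : ∃ r, t < r ∧ IsRecord α r := ⟨s, hts, hs⟩
  exact ⟨Nat.find hex, (Nat.find_spec hex).2, (Nat.find_spec hex).1, Nat.find_min' hex ⟨hts, hs⟩,
    fun z h1 h2 h3 => Nat.find_min hex h2 ⟨h1, h3⟩⟩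

lemma exists_prev_isConsec {α : ℝ} {e f : ℕ} (he : IsRecord α e) (hf : IsRecord α f)
    (hef : e < f) : ∃ s, e ≤ s ∧ IsConsec α s f := by
  obtain ⟨s, hs, -⟩ := exists_isLastRecord α (t := f - 1) (by have := he.1; omega)
  refine ⟨s, ?_, hs.1, hf, by have := hs.2.1; omega, fun z h1 h2 => hs.2.2 z h1 (by omega)⟩
  by_contra! hlt
  exact hs.2.2 e hlt (by omega) he

lemma IsLastRecord.exists_isConsec {α : ℝ} {t x z : ℕ} (hx : IsLastRecord α t x)
    (hz : IsRecord α z) (htz : t < z) : ∃ y, IsConsec α x y ∧ t < y ∧ y ≤ z := by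
  obtain ⟨y, hy, hty, hyz, hno⟩ := exists_first_isRecord hz htz
  have := hx.2.1
  refine ⟨y, ⟨hx.1, hy, by omega, fun w h1 h2 => ?_⟩, hty, hyz⟩
  rcases Nat.lt_or_ge t w with h | h
  · exact hno w h h2
  · exact hx.2.2 w h1 h

lemma IsRecord.err_pos {α : ℝ} (h : Irrational α) {x : ℕ} (hx : IsRecord α x) :
    0 < |err α x| :=
  abs_pos.2 (err_ne_zero h hx.1)

lemma IsRecord.err_lt {α : ℝ} {x y : ℕ} (hx : IsRecord α x) (hy : IsRecord α y) (hxy : x < y) :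
    |err α y| < |err α x| :=
  hy.2 x hx.1 hxy

lemma IsRecord.cast_pos {α : ℝ} {x : ℕ} (hx : IsRecord α x) : (0 : ℝ) < x := by
  exact_mod_cast hx.1

lemma det_eq_intCast (α : ℝ) (x y : ℕ) :
    (x : ℝ) * err α y - y * err α x
      = ((y * round ((x : ℝ) * α) - x * round ((y : ℝ) * α) : ℤ) : ℝ) := by
  simp only [err]
  push_cast
  ring

lemma IsRecord.mul_err_lt {α : ℝ} (h : Irrational α) {x y : ℕ} (hx : IsRecord α x)
    (hy : IsRecord α y) (hxy : x < y) : x * |err α y| < y * |err α x| := by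
  have h1 := hx.err_lt hy hxy
  have h2 := hy.err_pos h
  have h3 : (x : ℝ) < y := by exact_mod_cast hxy
  have h4 := hx.cast_pos
  nlinarith

lemma IsRecord.exists_abs_det {α : ℝ} (h : Irrational α) {x y : ℕ} (hx : IsRecord α x)
    (hy : IsRecord α y) (hxy : x < y) :
    ∃ n : ℤ, 1 ≤ n ∧ |x * err α y - y * err α x| = n := by
  refine ⟨_, ?_, by rw [det_eq_intCast, ← Int.cast_abs]⟩
  rw [← zero_add (1 : ℤ), Int.add_one_le_iff, abs_pos]
  intro h0
  have h1 := det_eq_intCast α x y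
  rw [h0, Int.cast_zero, sub_eq_zero] at h1
  have h2 := hx.mul_err_lt h hy hxy
  have h3 := congrArg abs h1
  rw [abs_mul, abs_mul, Nat.abs_cast, Nat.abs_cast] at h3
  exact h2.ne h3

lemma IsRecord.one_le_abs_det {α : ℝ} (h : Irrational α) {x y : ℕ} (hx : IsRecord α x)
    (hy : IsRecord α y) (hxy : x < y) : 1 ≤ |x * err α y - y * err α x| := by
  obtain ⟨n, hn, he⟩ := hx.exists_abs_det h hy hxy
  rw [he]
  exact_mod_cast hn

lemma abs_det_le (α : ℝ) (x y : ℕ) :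
    |x * err α y - y * err α x| ≤ x * |err α y| + y * |err α x| := by
  refine (abs_sub _ _).trans ?_
  rw [abs_mul, abs_mul, Nat.abs_cast, Nat.abs_cast]

lemma IsRecord.abs_det_of_mul_pos {α : ℝ} (h : Irrational α) {x y : ℕ} (hx : IsRecord α x)
    (hy : IsRecord α y) (hxy : x < y) (hs : 0 < err α x * err α y) :
    |x * err α y - y * err α x| = y * |err α x| - x * |err α y| := by
  have h1 := hx.mul_err_lt h hy hxy
  rcases pos_and_pos_or_neg_and_neg_of_mul_pos hs with ⟨h2, h3⟩ | ⟨h2, h3⟩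
  · rw [abs_of_pos h2, abs_of_pos h3] at *
    rw [abs_of_neg (by linarith)]; ring
  · rw [abs_of_neg h2, abs_of_neg h3] at *
    rw [abs_of_pos (by linarith)]; ring

lemma IsConsec.mul_err_le_one {α : ℝ} {x y : ℕ} (hc : IsConsec α x y) : y * |err α x| ≤ 1 := by
  have hx := hc.1.1
  have hxy := hc.2.2.1
  obtain ⟨m, rfl⟩ : ∃ m, y = m + 1 := ⟨y - 1, by omega⟩
  have h1 := psi_le_inv α (t := m) (by omega)
  rw [(hc.isLastRecord (t := m) (by omega) (by omega)).psi_eq, le_div_iff₀ (by positivity)] at h1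
  push_cast
  linarith

lemma IsConsec.mul_neg {α : ℝ} (h : Irrational α) {x y : ℕ} (hc : IsConsec α x y) :
    err α x * err α y < 0 := by
  by_contra! hs
  have hs' : 0 < err α x * err α y :=
    lt_of_le_of_ne hs (mul_ne_zero (err_ne_zero h hc.1.1) (err_ne_zero h hc.2.1.1)).symm
  have h1 := hc.1.abs_det_of_mul_pos h hc.2.1 hc.2.2.1 hs'
  have h2 := hc.1.one_le_abs_det h hc.2.1 hc.2.2.1
  have h3 := hc.mul_err_le_one
  have h4 := mul_pos hc.1.cast_pos (hc.2.1.err_pos h)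
  linarith

lemma IsConsec.add_eq_one {α : ℝ} (h : Irrational α) {x y : ℕ} (hc : IsConsec α x y) :
    x * |err α y| + y * |err α x| = 1 := by
  have h1 : |x * err α y - y * err α x| = x * |err α y| + y * |err α x| := by
    have hx := hc.1.cast_pos
    have hy := hc.2.1.cast_pos
    rcases mul_neg_iff.1 (hc.mul_neg h) with ⟨h2, h3⟩ | ⟨h2, h3⟩
    · rw [abs_of_pos h2, abs_of_neg h3, abs_of_neg (by nlinarith)]; ring
    · rw [abs_of_neg h2, abs_of_pos h3, abs_of_pos (by nlinarith)]; ring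
  obtain ⟨n, hn, he⟩ := hc.1.exists_abs_det h hc.2.1 hc.2.2.1
  have h2 : (n : ℝ) < 2 := by
    have := hc.1.mul_err_lt h hc.2.1 hc.2.2.1
    have := hc.mul_err_le_one
    linarith
  have h3 : n < 2 := by exact_mod_cast h2
  rw [← h1, he, show n = 1 by omega, Int.cast_one]

/-- If `psi α` is below `psi β` at two consecutive best approximation denominators of `β`, then
`psi α` does not drop in between. -/
lemma IsConsec.not_isRecord_of_psi_lt {α β : ℝ} (hα : Irrational α) (hβ : Irrational β) {x y : ℕ}
    (hc : IsConsec β x y) (h1 : psi α x < psi β x) (h2 : psi α y < psi β y) {z : ℕ}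
    (hxz : x < z) (hzy : z ≤ y) : ¬ IsRecord α z := by
  intro hz
  obtain ⟨p, hp, hpe⟩ := exists_isLastRecord α hc.1.1
  obtain ⟨q, hq, hqe⟩ := exists_isLastRecord α hc.2.1.1
  have hpx := hp.2.1
  have hqy := hq.2.1
  have hzq : z ≤ q := by
    by_contra! hlt
    exact hq.2.2 z hlt hzy hz
  have hdet := hp.1.one_le_abs_det hα hq.1 (by omega)
  have hle := abs_det_le α p q
  have hone := hc.add_eq_one hβ
  rw [hpe, hc.1.psi_eq] at h1
  rw [hqe, hc.2.1.psi_eq] at h2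
  have e1 : (p : ℝ) * |err α q| ≤ x * |err β y| :=
    mul_le_mul (by exact_mod_cast hpx) h2.le (abs_nonneg _) (Nat.cast_nonneg _)
  have e2 : (q : ℝ) * |err α p| < y * |err β x| :=
    mul_lt_mul' (by exact_mod_cast hqy) h1 (abs_nonneg _) hc.2.1.cast_pos
  linarith

/-- If `psi α` is below `psi β` at time `t`, then `psi α` drops at most once up to the next drop
of `psi β`. -/
lemma not_two_records {α β : ℝ} (hα : Irrational α) {t r y z : ℕ} (ht : 1 ≤ t)
    (h : psi α t < psi β t) (hr : IsRecord β r) (htr : t < r)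
    (hno : ∀ w, t < w → w < r → ¬ IsRecord β w) (hy : IsRecord α y) (hz : IsRecord α z)
    (hty : t < y) (hyz : y < z) (hzr : z ≤ r) : False := by
  obtain ⟨x₀, hx₀, hx₀e⟩ := exists_isLastRecord α ht
  obtain ⟨x₁, hc₁, htx₁, hx₁y⟩ := hx₀.exists_isConsec hy hty
  have hlast : IsLastRecord α x₁ x₁ := ⟨hc₁.2.1, le_rfl, fun _ h1 h2 => absurd h1 (by omega)⟩
  obtain ⟨x₂, hc₂, -, hx₂z⟩ := hlast.exists_isConsec hz (by omega)
  have hs : 0 < err α x₀ * err α x₂ := by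
    have h1 := hc₁.mul_neg hα
    have h2 := hc₂.mul_neg hα
    have h3 := mul_pos_of_neg_of_neg h1 h2
    have h4 : 0 < err α x₁ ^ 2 := by
      have := err_ne_zero hα hc₁.2.1.1
      positivity
    nlinarith
  have h02 : x₀ < x₂ := hc₁.2.2.1.trans hc₂.2.2.1
  have hdet := hc₁.1.one_le_abs_det hα hc₂.2.1 h02
  rw [hc₁.1.abs_det_of_mul_pos hα hc₂.2.1 h02 hs] at hdet
  obtain ⟨b, hb, hbe⟩ := exists_isLastRecord β ht
  have hcb : IsConsec β b r := ⟨hb.1, hr, by have := hb.2.1; omega, fun w h1 h2 => by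
    rcases Nat.lt_or_ge t w with h3 | h3
    · exact hno w h3 h2
    · exact hb.2.2 w h1 h3⟩
  have h1 := hcb.mul_err_le_one
  rw [hx₀e, hbe] at h
  have h2 : (x₂ : ℝ) * |err α x₀| < r * |err β b| :=
    mul_lt_mul' (by exact_mod_cast hx₂z.trans hzr) h (abs_nonneg _) hr.cast_pos
  have h3 := mul_pos hc₁.1.cast_pos (hc₂.2.1.err_pos hα)
  linarith

/-- If `x < y < z` are consecutive drops of `psi β`, `psi α` is above `psi β` at `x`, and both
drop at `z` with `psi α` ending below, then `psi α` drops between `x` and `y`. -/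
lemma IsConsec.exists_isRecord_between {α β : ℝ} (hα : Irrational α) (hβ : Irrational β)
    {x y z : ℕ} (hxy : IsConsec β x y) (hyz : IsConsec β y z) (h1 : psi β x < psi α x)
    (hz : IsRecord α z) (h2 : psi α z < psi β z) : ∃ w, x < w ∧ w < y ∧ IsRecord α w := by
  by_contra! hno
  have hxz : x < z := hxy.2.2.1.trans hyz.2.2.1
  obtain ⟨p, hp, hpe⟩ := exists_isLastRecord α hxy.1.1
  obtain ⟨r, hpr, hxr, hrz⟩ := hp.exists_isConsec hz hxz
  have hyr : y ≤ r := by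
    by_contra! hlt
    exact hno r hxr hlt hpr.2.1
  have hpx := hp.2.1
  have hs : 0 < err β x * err β z := by
    have h1 := hxy.mul_neg hβ
    have h2 := hyz.mul_neg hβ
    have h3 := mul_pos_of_neg_of_neg h1 h2
    have h4 : 0 < err β y ^ 2 := by
      have := err_ne_zero hβ hyz.1.1
      positivity
    nlinarith
  obtain ⟨n, hn, hne⟩ := hxy.1.exists_abs_det hβ hyz.2.1 hxz
  rw [hxy.1.abs_det_of_mul_pos hβ hyz.2.1 hxz hs] at hne
  obtain ⟨N, -, hNe⟩ := hp.1.exists_abs_det hα hz (by omega)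
  have hNle := abs_det_le α p z
  have hNge : z * |err α p| - p * |err α z| ≤ |p * err α z - z * err α p| := by
    have := abs_sub_abs_le_abs_sub (z * err α p) (p * err α z)
    rwa [abs_mul, abs_mul, Nat.abs_cast, Nat.abs_cast, abs_sub_comm] at this
  rw [hNe] at hNge hNle
  rw [hpe, hxy.1.psi_eq] at h1
  rw [hz.psi_eq, hyz.2.1.psi_eq] at h2
  have o1 := hxy.add_eq_one hβ
  have o2 := hyz.add_eq_one hβ
  have o3 := hpr.add_eq_one hα
  have hz0 := hz.cast_pos
  have hr0 := hpr.2.1.cast_pos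
  have hp0 := hp.1.cast_pos
  have hx0 := hxy.1.cast_pos
  have hxr' : (x : ℝ) < y := by exact_mod_cast hxy.2.2.1
  have hyr' : (y : ℝ) ≤ r := by exact_mod_cast hyr
  have hrz' : (r : ℝ) ≤ z := by exact_mod_cast hrz
  have hpx' : (p : ℝ) ≤ x := by exact_mod_cast hpx
  have hnN : n < N := by
    have e1 : (z : ℝ) * |err β x| < z * |err α p| := mul_lt_mul_of_pos_left h1 hz0
    have e2 : (p : ℝ) * |err α z| ≤ x * |err β z| :=
      mul_le_mul hpx' h2.le (abs_nonneg _) hx0.le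
    have : (n : ℝ) < N := by linarith
    exact_mod_cast this
  have hnN' : (n : ℝ) + 1 ≤ N := by exact_mod_cast hnN
  have hns : (n : ℝ) * y = z - x := by
    rw [← hne]; linear_combination (z : ℝ) * o1 - x * o2
  have hrec : |err α z| ≤ |err α r| := by
    rcases Nat.eq_or_lt_of_le hrz with h | h
    · rw [h]
    · exact (hpr.2.1.err_lt hz h).le
  have hNr : (N : ℝ) * r ≤ z := by
    have e1 : (r : ℝ) * |err α z| ≤ z * |err α r| :=
      mul_le_mul hrz' hrec (abs_nonneg _) hz0.le
    have e2 := mul_le_mul_of_nonneg_left e1 hp0.le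
    have e3 := mul_le_mul_of_nonneg_right hNle hr0.le
    have e4 : (z : ℝ) * (p * |err α r| + r * |err α p|) = z := by rw [o3, mul_one]
    linarith
  have hfin : ((n : ℝ) + 1) * y ≤ N * r :=
    mul_le_mul hnN' hyr' (Nat.cast_nonneg _) (by
      have : (0 : ℝ) < n := by exact_mod_cast hn
      linarith)
  linarith

lemma IsConsec.abs_int_det {α : ℝ} (h : Irrational α) {x y : ℕ} (hc : IsConsec α x y) :
    |(y * round ((x : ℝ) * α) - x * round ((y : ℝ) * α) : ℤ)| = 1 := by
  have h1 := det_eq_intCast α x y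
  have hx := hc.1.cast_pos
  have hy := hc.2.1.cast_pos
  have h2 : |x * err α y - y * err α x| = 1 := by
    rw [← hc.add_eq_one h]
    rcases mul_neg_iff.1 (hc.mul_neg h) with ⟨h2, h3⟩ | ⟨h2, h3⟩
    · rw [abs_of_pos h2, abs_of_neg h3, abs_of_neg (by nlinarith)]; ring
    · rw [abs_of_neg h2, abs_of_pos h3, abs_of_pos (by nlinarith)]; ring
  rw [h1, ← Int.cast_abs] at h2
  exact_mod_cast h2

lemma IsConsec.dvd_sub {α : ℝ} (h : Irrational α) {w x y : ℕ} (hwx : IsConsec α w x)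
    (hxy : IsConsec α x y) : (x : ℤ) ∣ y - w := by
  have hd := hxy.abs_int_det h
  have hw := hwx.1.cast_pos
  have hx := hxy.1.cast_pos
  have hy := hxy.2.1.cast_pos
  have h1 := hwx.add_eq_one h
  have h2 := hxy.add_eq_one h
  have e0 : (w * err α x - x * err α w) + (x * err α y - y * err α x) = 0 := by
    rcases mul_neg_iff.1 (hwx.mul_neg h) with ⟨a1, a2⟩ | ⟨a1, a2⟩ <;>
      rcases mul_neg_iff.1 (hxy.mul_neg h) with ⟨b1, b2⟩ | ⟨b1, b2⟩
    · linarith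
    · rw [abs_of_pos a1, abs_of_neg a2] at h1
      rw [abs_of_neg b1, abs_of_pos b2] at h2
      linarith
    · rw [abs_of_neg a1, abs_of_pos a2] at h1
      rw [abs_of_pos b1, abs_of_neg b2] at h2
      linarith
    · linarith
  rw [det_eq_intCast, det_eq_intCast] at e0
  have e1 : (x * round ((w : ℝ) * α) - w * round ((x : ℝ) * α) : ℤ)
      + (y * round ((x : ℝ) * α) - x * round ((y : ℝ) * α) : ℤ) = 0 := by exact_mod_cast e0
  generalize round ((w : ℝ) * α) = a at *
  generalize round ((x : ℝ) * α) = b at *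
  generalize round ((y : ℝ) * α) = c at *
  have key : (x : ℤ) ∣ (y - w) * (y * b - x * c) :=
    ⟨y * (c - a) - c * (y - w), by linear_combination (y : ℤ) * e1⟩
  rcases (abs_eq (by norm_num)).1 hd with h | h
  · rwa [h, mul_one] at key
  · rwa [h, mul_neg_one, dvd_neg] at key

/-- Two numbers sharing a pair of consecutive best approximation denominators share all the
smaller ones. -/
lemma isRecord_iff_of_isConsec {α β : ℝ} (hα : Irrational α) (hβ : Irrational β) {x y : ℕ}
    (h1 : IsConsec α x y) (h2 : IsConsec β x y) :
    ∀ z ≤ y, (IsRecord α z ↔ IsRecord β z) := by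
  induction x using Nat.strong_induction_on generalizing y with
  | _ x ih =>
    have one_rec : ∀ γ, IsRecord γ 1 := fun γ => ⟨le_rfl, fun m h1 h2 => absurd h1 (by omega)⟩
    have below : ∀ z ≤ x, (IsRecord α z ↔ IsRecord β z) := by
      rcases Nat.eq_or_lt_of_le h1.1.1 with hx | hx
      · intro z hz
        rcases Nat.eq_zero_or_pos z with h0 | h0
        · exact iff_of_false (fun h => absurd h.1 (by omega)) fun h => absurd h.1 (by omega)
        · obtain rfl : z = 1 := by omega
          exact iff_of_true (one_rec _) (one_rec _)
      · obtain ⟨w, hw, hcw⟩ := exists_prev_isConsec (one_rec α) h1.1 hx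
        obtain ⟨w', hw', hcw'⟩ := exists_prev_isConsec (one_rec β) h2.1 hx
        have hww : w = w' := by
          have d := dvd_sub (hcw.dvd_sub hα h1) (hcw'.dvd_sub hβ h2)
          have := hcw.2.2.1
          have := hcw'.2.2.1
          have h0 := Int.eq_zero_of_abs_lt_dvd d (by rw [abs_lt]; omega)
          omega
        exact ih w hcw.2.2.1 hcw (hww ▸ hcw')
    intro z hz
    rcases Nat.lt_or_ge x z with h | h
    · rcases Nat.eq_or_lt_of_le hz with rfl | h'
      · exact iff_of_true h1.2.1 h2.2.1
      · exact iff_of_false (h1.2.2.2 z h h') (h2.2.2.2 z h h')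
    · exact below z h

/-- If `psi α` and `psi β` are eventually different, they eventually do not share two consecutive
drops. -/
lemma exists_forall_not_isConsec {α β : ℝ} (hα : Irrational α) (hβ : Irrational β) {T₀ : ℕ}
    (hne : ∀ t : ℕ, T₀ ≤ t → psi α t ≠ psi β t) :
    ∃ T : ℕ, ∀ x y, T ≤ x → IsConsec α x y → ¬ IsConsec β x y := by
  by_contra! hall
  have hrec : ∀ z, IsRecord α z ↔ IsRecord β z := fun z => by
    obtain ⟨x, y, hx, h1, h2⟩ := hall z
    exact isRecord_iff_of_isConsec hα hβ h1 h2 z (hx.trans h1.2.2.1.le)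
  have hcon : ∀ x y, IsConsec α x y → IsConsec β x y := fun x y h =>
    ⟨(hrec x).1 h.1, (hrec y).1 h.2.1, h.2.2.1, fun z h1 h2 h3 => h.2.2.2 z h1 h2 ((hrec z).2 h3)⟩
  obtain ⟨x₀, hx₀T, hx₀⟩ := exists_isRecord_gt hα T₀
  have hpos : 0 < |(|err α x₀| - |err β x₀|)| := by
    rw [abs_pos, sub_ne_zero, ← hx₀.psi_eq, ← ((hrec x₀).1 hx₀).psi_eq]
    exact hne x₀ hx₀T.le
  have hmono : ∀ z, x₀ ≤ z → IsRecord α z →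
      |(|err α x₀| - |err β x₀|)| ≤ |(|err α z| - |err β z|)| := by
    intro z
    induction z using Nat.strong_induction_on with
    | _ z ih =>
      intro hz hzr
      rcases Nat.eq_or_lt_of_le hz with rfl | hlt
      · exact le_rfl
      · obtain ⟨s, hs, hc⟩ := exists_prev_isConsec hx₀ hzr hlt
        refine (ih s hc.2.2.1 hs hc.1).trans ?_
        have o1 := hc.add_eq_one hα
        have o2 := (hcon _ _ hc).add_eq_one hβ
        have e : s * (|err α z| - |err β z|) = -(z * (|err α s| - |err β s|)) := by
          linear_combination o1 - o2
        have e' := congrArg abs e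
        rw [abs_neg, abs_mul, abs_mul, Nat.abs_cast, Nat.abs_cast] at e'
        have hs0 := hc.1.cast_pos
        have hsz : (s : ℝ) ≤ z := by exact_mod_cast hc.2.2.1.le
        by_contra! hlt'
        have : (s : ℝ) * |(|err α z| - |err β z|)| < z * |(|err α s| - |err β s|)| :=
          (mul_lt_mul_of_pos_left hlt' hs0).trans_le
            (mul_le_mul_of_nonneg_right hsz (abs_nonneg _))
        linarith
  obtain ⟨n, hn⟩ := exists_nat_one_div_lt hpos
  obtain ⟨z, hzn, hz⟩ := exists_isRecord_gt hα (n + x₀)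
  have h1 := hmono z (by omega) hz
  have h2 := psi_le_inv α hz.1
  have h3 := psi_le_inv β hz.1
  rw [hz.psi_eq] at h2
  rw [((hrec z).1 hz).psi_eq] at h3
  have h4 : (1 : ℝ) / (z + 1) ≤ 1 / (n + 1) := by
    apply one_div_le_one_div_of_le
    · positivity
    · have : (n : ℝ) ≤ z := by exact_mod_cast (by omega)
      linarith
  have h5 : |(|err α z| - |err β z|)| ≤ 1 / (z + 1) := by
    rw [abs_le]
    constructor <;> linarith [abs_nonneg (err α z), abs_nonneg (err β z)]
  linarith

/-- Neither of two irrationality measure functions stays strictly above the other. -/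
lemma exists_psi_lt {α β : ℝ} (hα : Irrational α) (hβ : Irrational β) {T₀ : ℕ}
    (hne : ∀ t : ℕ, T₀ ≤ t → psi α t ≠ psi β t) : ∃ t : ℕ, T₀ ≤ t ∧ psi α t < psi β t := by
  by_contra! hle
  obtain ⟨x₀, hx₀T, hx₀⟩ := exists_isRecord_gt hα T₀
  obtain ⟨z, hxz, hz⟩ := exists_isRecord_gt hβ x₀
  obtain ⟨u, huz, hu⟩ := exists_isRecord_gt hα z
  obtain ⟨s, hs, -⟩ := exists_isLastRecord α (t := z - 1) (by have := hx₀.1; omega)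
  have hxs : x₀ ≤ s := by
    by_contra! hlt
    exact hs.2.2 x₀ hlt (by omega) hx₀
  obtain ⟨y, hsy, hy, -⟩ := hs.exists_isConsec hu (by omega)
  have hlt : ∀ t : ℕ, T₀ ≤ t → psi β t < psi α t := fun t ht =>
    lt_of_le_of_ne (hle t ht) (hne t ht).symm
  have := hs.2.1
  exact hsy.not_isRecord_of_psi_lt hβ hα (hlt s (by omega)) (hlt y (by omega)) (z := z)
    (by omega) (by omega) hz

/-- If `psi β` drops at `e` and `f` and stays above `psi α`, then `psi α` does not drop at `f`. -/
lemma not_isRecord_of_forall_psi_lt {α β : ℝ} (hα : Irrational α) (hβ : Irrational β) {e f : ℕ}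
    (hef : e < f) (he : IsRecord β e) (hf : IsRecord β f)
    (h : ∀ t : ℕ, e ≤ t → t ≤ f → psi α t < psi β t) : ¬ IsRecord α f := by
  obtain ⟨s, hes, hs⟩ := exists_prev_isConsec he hf hef
  have := hs.2.2.1
  exact hs.not_isRecord_of_psi_lt hα hβ (h s hes (by omega)) (h f hef.le le_rfl) (by omega) le_rfl

/-- If `psi γ` stays above `psi β` on `[e, f)`, which stays above `psi α`, and both `psi α` and
`psi β` drop at `e` and `f`, then `psi γ` does not drop at `f`. -/
lemma not_isRecord_of_chain {α β γ : ℝ} (hα : Irrational α) (hβ : Irrational β)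
    (hγ : Irrational γ) {e f : ℕ} (hne : psi β f ≠ psi γ f)
    (hcon : ∀ x y, e ≤ x → IsConsec α x y → ¬ IsConsec β x y) (hef : e < f)
    (hαe : IsRecord α e) (hαf : IsRecord α f) (hβe : IsRecord β e) (hβf : IsRecord β f)
    (h1 : ∀ t : ℕ, e ≤ t → t < f → psi α t < psi β t)
    (h2 : ∀ t : ℕ, e ≤ t → t < f → psi β t < psi γ t) : ¬ IsRecord γ f := by
  intro hγf
  have hinner : ∃ w, IsRecord β w ∧ e < w ∧ w < f := by
    by_contra! hno
    refine hcon e f le_rfl ⟨hαe, hαf, hef, fun z hz1 hz2 hz => ?_⟩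
      ⟨hβe, hβf, hef, fun z hz1 hz2 hz => absurd (hno z hz hz1) (by omega)⟩
    exact not_two_records hα hβe.1 (h1 e le_rfl hef) hβf hef
      (fun w hw1 hw2 hw => absurd (hno w hw hw1) (by omega)) hz hαf hz1 hz2 le_rfl
  obtain ⟨w, hw, hew, hwf⟩ := hinner
  have he := hβe.1
  rcases hne.lt_or_gt with hlt | hlt
  · refine not_two_records hβ he (h2 e le_rfl hef) hγf hef (fun g hg1 hg2 hg => ?_) hw hβf hew hwf
      le_rfl
    refine not_isRecord_of_forall_psi_lt hβ hγ hg2 hg hγf (fun t ht1 ht2 => ?_) hβf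
    rcases Nat.eq_or_lt_of_le ht2 with rfl | h
    · exact hlt
    · exact h2 t (by omega) h
  · obtain ⟨s, hws, hs⟩ := exists_prev_isConsec hw hβf hwf
    obtain ⟨T, heT, hT⟩ := exists_prev_isConsec hβe hs.1 (by omega)
    have hsf := hs.2.2.1
    have hTs := hT.2.2.1
    obtain ⟨v, hTv, hvs, hv⟩ := hT.exists_isRecord_between hγ hβ hs (h2 T heT (by omega)) hγf hlt
    obtain ⟨r, hvr, hr⟩ : ∃ r, v ≤ r ∧ IsLastRecord γ (s - 1) r := by
      obtain ⟨r, hr, -⟩ := exists_isLastRecord γ (t := s - 1) (by omega)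
      refine ⟨r, ?_, hr⟩
      by_contra! h
      exact hr.2.2 v h (by omega) hv
    obtain ⟨r', hc, hsr', hr'f⟩ := hr.exists_isConsec hγf (by omega)
    have hrs := hr.2.1
    rcases Nat.eq_or_lt_of_le hr'f with rfl | hlt'
    · exact not_two_records hβ hc.1.1 (h2 r (by omega) (by omega)) hγf hc.2.2.1 hc.2.2.2 hs.1 hβf
        (by omega) hsf le_rfl
    · exact hc.not_isRecord_of_psi_lt hβ hγ (h2 r (by omega) (by omega)) (h2 r' (by omega) hlt')
        (z := s) (by omega) (by omega) hs.1

/-- The set of pairs `(i, j)`, `i, j < 6`, coded by `m` contains `(i, j)`; this will mean that the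
`i`-th function is known to be above the `j`-th one. -/
def knows (m i j : ℕ) : Bool := m.testBit (6 * i + j)

/-- Function `i` is known to drop at the change between two phases with known relations `p`
and `q`. -/
def drops (p q N i : ℕ) : Bool := (List.range N).any fun j => knows p i j && knows q j i

/-- Function `i` is known to be above `j` in the phases with known relations `L`. -/
def stays (L : List ℕ) (i j : ℕ) : Bool := L.all fun m => knows m i j

/-- The known relations among the first `N` functions are contradictory because of what happens at
two changes, the first from `p` to `q` and the second from `r` to `s`, with phases `L` in between.
-/
def clash (N p q : ℕ) (L : List ℕ) (r s : ℕ) : Bool :=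
  (List.range N).any fun k => drops p q N k && drops r s N k &&
    ((List.range N).any fun l => drops r s N l &&
      ((stays L k l && knows s k l) ||
       (stays L l k && (List.range N).any fun j =>
         stays L k j && drops p q N j && drops r s N j)))

/-- The known relations in five consecutive phases with orders `a, b, a, c, x` are
contradictory. -/
def clashes (N a b c x : ℕ) : Bool :=
  clash N a b [b] b a || clash N b a [a] a c || clash N a c [c] c x ||
  clash N a b [b, a] a c || clash N b a [a, c] c x || clash N a b [b, a, c] c x

/-- The relations `m` contain a directed triangle on `i`, `j` and some `k < i`. -/
def cyclic (m i j : ℕ) : Bool :=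
  (List.range i).any fun k =>
    (knows m i j && knows m j k && knows m k i) || (knows m j i && knows m i k && knows m k j)

/-- `f n`, in a form that makes the kernel compute `n` first. -/
def force (n : ℕ) (f : ℕ → Bool) : Bool :=
  match n with
  | 0 => f 0
  | k + 1 => f (k + 1)

lemma force_eq (n : ℕ) (f : ℕ → Bool) : force n f = f n := by
  cases n <;> rfl

/-- Every way of ordering the listed pairs in phases `b` and `c`, inverting each of them at least
once with respect to `a`, is contradictory. -/
def refuted (back : Bool) (a : ℕ) : List (ℕ × ℕ) → ℕ → ℕ → Bool
  | [], _, _ => false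
  | (i, j) :: ps, b, c =>
    [((j, i), (j, i)), ((j, i), (i, j)), ((i, j), (j, i))].all fun p =>
      force (b ||| 2 ^ (6 * p.1.1 + p.1.2)) fun b => force (c ||| 2 ^ (6 * p.2.1 + p.2.2)) fun c =>
        cyclic b i j || cyclic c i j ||
        (decide (i + 1 = j) && clashes (j + 1) a b c (if back then a else b)) ||
        refuted back a ps b c

/-- The pairs `(i, j)` with `i < j < 6`. -/
def indexPairs : List (ℕ × ℕ) :=
  [(0, 1), (0, 2), (1, 2), (0, 3), (1, 3), (2, 3), (0, 4), (1, 4), (2, 4), (3, 4),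
    (0, 5), (1, 5), (2, 5), (3, 5), (4, 5)]

/-- The relations of the decreasing order. -/
def decreasingMask : ℕ := indexPairs.foldl (fun m p => m ||| 2 ^ (6 * p.1 + p.2)) 0

lemma refuted_decreasingMask (back : Bool) :
    refuted back decreasingMask indexPairs 0 0 = true := by
  cases back <;> decide +kernel

/-- Five consecutive phases of six functions: `F g i` is the value of the `i`-th function in phase
`g`, and `R e i` says that it drops at the change between phases `e` and `e + 1`. -/
structure Phases (F : ℕ → ℕ → ℝ) (R : ℕ → ℕ → Prop) : Prop where
  drop : ∀ e < 4, ∀ i < 6, ∀ j < 6, F e j < F e i → F (e + 1) i < F (e + 1) j → R e i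
  not_above : ∀ e f, e < f → f < 4 → ∀ k < 6, ∀ l < 6, R e k → R f k → R f l →
    ¬ ∀ g, e < g → g ≤ f + 1 → F g l < F g k
  not_chain : ∀ e f, e < f → f < 4 → ∀ j < 6, ∀ k < 6, ∀ l < 6,
    R e j → R f j → R e k → R f k → R f l →
    (∀ g, e < g → g ≤ f → F g j < F g k) → ¬ ∀ g, e < g → g ≤ f → F g k < F g l

/-- The relations coded by `m` hold for the values `F`. -/
def Sound (m : ℕ) (F : ℕ → ℝ) : Prop :=
  ∀ i < 6, ∀ j < 6, knows m i j = true → F j < F i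

lemma Sound.insert {m : ℕ} {F : ℕ → ℝ} (h : Sound m F) {u v : ℕ} (hv : v < 6)
    (huv : F v < F u) : Sound (m ||| 2 ^ (6 * u + v)) F := by
  intro i hi j hj hk
  simp only [knows, Nat.testBit_or, Nat.testBit_two_pow, Bool.or_eq_true, decide_eq_true_eq] at hk
  rcases hk with hk | hk
  · exact h i hi j hj hk
  · obtain rfl : u = i := by omega
    obtain rfl : v = j := by omega
    exact huv

lemma Sound.not_cyclic {m : ℕ} {F : ℕ → ℝ} (h : Sound m F) {i j : ℕ} (hi : i < 6) (hj : j < 6) :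
    ¬ cyclic m i j = true := by
  simp only [cyclic, List.any_eq_true, List.mem_range, Bool.or_eq_true, Bool.and_eq_true]
  rintro ⟨k, hk, ⟨⟨h1, h2⟩, h3⟩ | ⟨⟨h1, h2⟩, h3⟩⟩
  · have := h _ hi _ hj h1
    have := h _ hj k (by omega) h2
    have := h k (by omega) _ hi h3
    linarith
  · have := h _ hj _ hi h1
    have := h _ hi k (by omega) h2
    have := h k (by omega) _ hj h3
    linarith

section

variable {F : ℕ → ℕ → ℝ} {R : ℕ → ℕ → Prop}

lemma Phases.of_drops (hP : Phases F R) {N p q e i : ℕ} (hp : Sound p (F e))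
    (hq : Sound q (F (e + 1))) (hN : N ≤ 6) (he : e < 4) (hi : i < 6)
    (h : drops p q N i = true) : R e i := by
  simp only [drops, List.any_eq_true, List.mem_range, Bool.and_eq_true] at h
  obtain ⟨j, hj, h1, h2⟩ := h
  exact hP.drop e he i hi j (by omega) (hp i hi j (by omega) h1) (hq j (by omega) i hi h2)

lemma Phases.not_clash (hP : Phases F R) {N p q r s e f : ℕ} {L : List ℕ} (hN : N ≤ 6)
    (hef : e < f) (hf : f < 4) (hp : Sound p (F e)) (hq : Sound q (F (e + 1)))
    (hL : ∀ g, e < g → g ≤ f → ∃ m ∈ L, Sound m (F g)) (hr : Sound r (F f))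
    (hs : Sound s (F (f + 1))) : ¬ clash N p q L r s = true := by
  have hL' : ∀ i < 6, ∀ j < 6, stays L i j = true → ∀ g, e < g → g ≤ f → F g j < F g i := by
    intro i hi j hj h g h1 h2
    obtain ⟨m, hm, hsound⟩ := hL g h1 h2
    exact hsound i hi j hj (List.all_eq_true.1 h m hm)
  simp only [clash, List.any_eq_true, List.mem_range, Bool.or_eq_true, Bool.and_eq_true]
  rintro ⟨k, hk, ⟨hke, hkf⟩, l, hl, hlf, ⟨h1, h2⟩ | ⟨h1, j, hj, ⟨h2, hje⟩, hjf⟩⟩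
  · refine hP.not_above e f hef hf k (by omega) l (by omega)
      (hP.of_drops hp hq hN (by omega) (by omega) hke) (hP.of_drops hr hs hN hf (by omega) hkf)
      (hP.of_drops hr hs hN hf (by omega) hlf) fun g hg1 hg2 => ?_
    rcases Nat.lt_or_ge f g with h | h
    · obtain rfl : g = f + 1 := by omega
      exact hs k (by omega) l (by omega) h2
    · exact hL' k (by omega) l (by omega) h1 g hg1 h
  · exact hP.not_chain e f hef hf j (by omega) k (by omega) l (by omega)
      (hP.of_drops hp hq hN (by omega) (by omega) hje) (hP.of_drops hr hs hN hf (by omega) hjf)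
      (hP.of_drops hp hq hN (by omega) (by omega) hke) (hP.of_drops hr hs hN hf (by omega) hkf)
      (hP.of_drops hr hs hN hf (by omega) hlf)
      (hL' k (by omega) j (by omega) h2) (hL' l (by omega) k (by omega) h1)

lemma Phases.not_clashes (hP : Phases F R) {N a b c x : ℕ} (hN : N ≤ 6) (h0 : Sound a (F 0))
    (h1 : Sound b (F 1)) (h2 : Sound a (F 2)) (h3 : Sound c (F 3)) (h4 : Sound x (F 4)) :
    ¬ clashes N a b c x = true := by
  simp only [clashes, Bool.or_eq_true, not_or]
  refine ⟨⟨⟨⟨⟨hP.not_clash (e := 0) (f := 1) hN ?_ ?_ h0 h1 ?_ h1 h2,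
    hP.not_clash (e := 1) (f := 2) hN ?_ ?_ h1 h2 ?_ h2 h3⟩,
    hP.not_clash (e := 2) (f := 3) hN ?_ ?_ h2 h3 ?_ h3 h4⟩,
    hP.not_clash (e := 0) (f := 2) hN ?_ ?_ h0 h1 ?_ h2 h3⟩,
    hP.not_clash (e := 1) (f := 3) hN ?_ ?_ h1 h2 ?_ h3 h4⟩,
    hP.not_clash (e := 0) (f := 3) hN ?_ ?_ h0 h1 ?_ h3 h4⟩
  all_goals first
    | norm_num
      done
    | intro g hg1 hg2
      interval_cases g <;> simp [*]

lemma Phases.not_refuted (hP : Phases F R) {back : Bool} {a : ℕ} (hF0 : Sound a (F 0))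
    (hF2 : Sound a (F 2))
    (hF4 : ∀ i < 6, ∀ j < 6, F (if back then 0 else 1) i < F (if back then 0 else 1) j →
      F 4 i < F 4 j)
    (hne : ∀ i < 6, ∀ j < 6, i ≠ j → F 3 i ≠ F 3 j)
    (hinv : ∀ i < 6, ∀ j < 6, i < j → F 1 i < F 1 j ∨ F 3 i < F 3 j ∧ F 1 j < F 1 i)
    (ps : List (ℕ × ℕ)) (hps : ∀ p ∈ ps, p.1 < p.2 ∧ p.2 < 6) (b c : ℕ) (hb : Sound b (F 1))
    (hc : Sound c (F 3)) : ¬ refuted back a ps b c = true := by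
  induction ps generalizing b c with
  | nil => simp [refuted]
  | cons p ps ih =>
    obtain ⟨i, j⟩ := p
    obtain ⟨hij, hj⟩ := hps (i, j) (by simp)
    dsimp only at hij hj
    have hi : i < 6 := by omega
    have step : ∀ b c : ℕ, Sound b (F 1) → Sound c (F 3) →
        ¬ ((cyclic b i j || cyclic c i j ||
          (decide (i + 1 = j) && clashes (j + 1) a b c (if back then a else b)) ||
          refuted back a ps b c) = true) := by
      intro b c hb hc h
      simp only [Bool.or_eq_true, Bool.and_eq_true] at h
      rcases h with ((h | h) | ⟨-, h⟩) | h
      · exact hb.not_cyclic hi hj h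
      · exact hc.not_cyclic hi hj h
      · refine hP.not_clashes (by omega) hF0 hb hF2 hc ?_ h
        cases back
        · exact fun i hi j hj hk => hF4 _ hj _ hi (hb i hi j hj hk)
        · exact fun i hi j hj hk => hF4 _ hj _ hi (hF0 i hi j hj hk)
      · exact ih (fun p hp => hps p (by simp [hp])) b c hb hc h
    intro h
    simp only [refuted, force_eq, List.all_cons, List.all_nil, Bool.and_true, Bool.and_eq_true] at h
    obtain ⟨h1, h2, h3⟩ := h
    rcases hinv i hi j hj hij with h | ⟨h, h'⟩
    · rcases (hne i hi j hj hij.ne).lt_or_gt with h' | h'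
      · exact step _ _ (hb.insert hi h) (hc.insert hi h') h1
      · exact step _ _ (hb.insert hi h) (hc.insert hj h') h2
    · exact step _ _ (hb.insert hj h') (hc.insert hi h) h3

/-- Phases with orders `a, b, a, c, a` or `a, b, a, c, b`, such that each pair is inverted in `b` or
in `c` with respect to `a`, do not exist. -/
lemma Phases.false (hP : Phases F R) (back : Bool)
    (hF0 : ∀ i < 6, ∀ j < 6, i < j → F 0 j < F 0 i)
    (hF2 : ∀ i < 6, ∀ j < 6, F 0 i < F 0 j → F 2 i < F 2 j)
    (hF4 : ∀ i < 6, ∀ j < 6, F (if back then 0 else 1) i < F (if back then 0 else 1) j →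
      F 4 i < F 4 j)
    (hne1 : ∀ i < 6, ∀ j < 6, i ≠ j → F 1 i ≠ F 1 j)
    (hne3 : ∀ i < 6, ∀ j < 6, i ≠ j → F 3 i ≠ F 3 j)
    (hinv : ∀ i < 6, ∀ j < 6, i < j → F 1 i < F 1 j ∨ F 3 i < F 3 j) : False := by
  have hdec : ∀ i < 6, ∀ j < 6, knows decreasingMask i j = true → i < j := by decide +kernel
  have h0 : Sound decreasingMask (F 0) := fun i hi j hj hk => hF0 i hi j hj (hdec i hi j hj hk)
  have hzero : ∀ G : ℕ → ℝ, Sound 0 G := fun G i _ j _ hk => by simp [knows] at hk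
  refine hP.not_refuted h0 (fun i hi j hj hk => hF2 _ hj _ hi (h0 i hi j hj hk)) hF4 hne3
    (fun i hi j hj hij => ?_) indexPairs (by decide) 0 0 (hzero _) (hzero _)
    (refuted_decreasingMask back)
  rcases (hne1 i hi j hj hij.ne).lt_or_gt with h | h
  · exact Or.inl h
  · exact Or.inr ⟨(hinv i hi j hj hij).resolve_left h.le.not_gt, h⟩

end

lemma exists_isOrderVec {n : ℕ} (α : Fin n → ℝ) {t : ℝ}
    (h : ∀ i j : Fin n, i ≠ j → psi (α i) t ≠ psi (α j) t) : ∃ v, IsOrderVec α t v := by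
  refine ⟨Tuple.sort fun i => -psi (α i) t, Equiv.bijective _, fun p q hpq => ?_⟩
  have hle := Tuple.monotone_sort (fun i => -psi (α i) t) hpq.le
  simp only [Function.comp_apply, neg_le_neg_iff] at hle
  exact lt_of_le_of_ne hle (h _ _ fun he => hpq.ne' (Equiv.injective _ he))

lemma IsOrderVec.lt_iff {n : ℕ} {α : Fin n → ℝ} {t : ℝ} {v : Fin n → Fin n}
    (h : IsOrderVec α t v) (p q : Fin n) : psi (α (v p)) t < psi (α (v q)) t ↔ q < p := by
  refine ⟨fun hlt => ?_, fun hlt => h.2 q p hlt⟩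
  by_contra! hle
  rcases hle.eq_or_lt with rfl | hlt'
  · exact lt_irrefl _ hlt
  · exact lt_asymm hlt (h.2 p q hlt')

lemma IsOrderVec.sameOrder {n : ℕ} {α : Fin n → ℝ} {t t' : ℝ} {v : Fin n → Fin n}
    (h : IsOrderVec α t v) (h' : IsOrderVec α t' v) : SameOrder α t t' := by
  intro i j
  obtain ⟨p, rfl⟩ := h.1.2 i
  obtain ⟨q, rfl⟩ := h.1.2 j
  rw [h.lt_iff, h'.lt_iff]

/-- If `kAlpha α = 3`, three different orders occurring late are all that occur late. -/
lemma exists_forall_sameOrder {n : ℕ} {α : Fin n → ℝ} (hind : PairwiseIndependent α)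
    (hk : kAlpha α = 3) : ∃ T : ℝ, ∀ r s u t : ℝ, T < r → T < s → T < u → T < t →
      ¬ SameOrder α r s → ¬ SameOrder α r u → ¬ SameOrder α s u →
      SameOrder α r t ∨ SameOrder α s t ∨ SameOrder α u t := by
  obtain ⟨T₀, -, hT₀⟩ := hind
  have hbd : ∀ v : Fin n → Fin n, ∃ T : ℝ, ¬ OccursInfinitely α v →
      ∀ t, T < t → ¬ IsOrderVec α t v := by
    intro v
    by_cases h : OccursInfinitely α v
    · exact ⟨0, fun h' => absurd h h'⟩
    · simp only [OccursInfinitely, not_forall, not_exists, not_and] at h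
      obtain ⟨T, hT⟩ := h
      exact ⟨T, fun _ => hT⟩
  choose T₁ hT₁ using hbd
  obtain ⟨T₂, hT₂⟩ := Set.finite_range T₁ |>.bddAbove
  have key : ∀ t, max T₀ T₂ < t → ∃ v, IsOrderVec α t v ∧ OccursInfinitely α v := by
    intro t ht
    obtain ⟨v, hv⟩ := exists_isOrderVec α (hT₀ t ((le_max_left _ _).trans ht.le))
    refine ⟨v, hv, ?_⟩
    by_contra h
    exact hT₁ v h t ((hT₂ ⟨v, rfl⟩).trans_lt ((le_max_right _ _).trans_lt ht)) hv
  refine ⟨max T₀ T₂, fun r s u t hr hs hu ht hrs hru hsu => ?_⟩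
  obtain ⟨a, ha, ha'⟩ := key r hr
  obtain ⟨b, hb, hb'⟩ := key s hs
  obtain ⟨c, hc, hc'⟩ := key u hu
  obtain ⟨d, hd, hd'⟩ := key t ht
  have hab : a ≠ b := fun h => hrs (ha.sameOrder (h ▸ hb))
  have hac : a ≠ c := fun h => hru (ha.sameOrder (h ▸ hc))
  have hbc : b ≠ c := fun h => hsu (hb.sameOrder (h ▸ hc))
  have hsub : ({a, b, c} : Set (Fin n → Fin n)) ⊆ {v | OccursInfinitely α v} := by
    rintro v (rfl | rfl | rfl)
    exacts [ha', hb', hc']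
  have heq := Set.eq_of_subset_of_ncard_le hsub (by
    rw [Set.ncard_eq_three.2 ⟨a, b, c, hab, hac, hbc, rfl⟩]
    exact hk.le) (Set.toFinite _)
  have hmem : d ∈ ({a, b, c} : Set (Fin n → Fin n)) := heq ▸ hd'
  rcases hmem with rfl | rfl | rfl
  exacts [Or.inl (ha.sameOrder hd), Or.inr (Or.inl (hb.sameOrder hd)),
    Or.inr (Or.inr (hc.sameOrder hd))]

lemma IsChangeSeq.lt_succ {n : ℕ} {α : Fin n → ℝ} {ts : ℕ → ℝ} (h : IsChangeSeq α ts) (i : ℕ) :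
    ts i < ts (i + 1) :=
  (h i).1.1

lemma IsChangeSeq.sameOrder {n : ℕ} {α : Fin n → ℝ} {ts : ℕ → ℝ} (h : IsChangeSeq α ts) {i : ℕ}
    {t : ℝ} (h1 : ts i < t) (h2 : t < ts (i + 1)) : SameOrder α (ts i) t := by
  by_contra hne
  exact h2.not_ge ((h i).2 ⟨h1, hne⟩)

lemma sameOrder_of_floor_eq {n : ℕ} (α : Fin n → ℝ) {s t : ℝ} (hs : 0 ≤ s) (ht : 0 ≤ t)
    (h : ⌊s⌋₊ = ⌊t⌋₊) : SameOrder α s t := by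
  intro i j
  rw [← psi_floor hs, ← psi_floor hs, ← psi_floor ht, ← psi_floor ht, h]

/-- Permutation changes happen at integers. -/
lemma IsChangeSeq.floor_eq {n : ℕ} {α : Fin n → ℝ} {ts : ℕ → ℝ} (h : IsChangeSeq α ts) {i : ℕ}
    (hi : 0 ≤ ts i) : (⌊ts (i + 1)⌋₊ : ℝ) = ts (i + 1) := by
  have h1 := h.lt_succ i
  have hi' : 0 ≤ ts (i + 1) := by linarith
  refine le_antisymm (Nat.floor_le hi') ?_
  rcases lt_or_ge (ts i) ⌊ts (i + 1)⌋₊ with hlt | hge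
  · refine (h i).2 ⟨hlt, fun hs => (h i).1.2 fun p q => (hs p q).trans ?_⟩
    rw [psi_floor hi', psi_floor hi']
  · exact absurd (sameOrder_of_floor_eq α hi hi' (le_antisymm (Nat.floor_mono h1.le)
      (Nat.le_floor hge))) (h i).1.2

lemma IsChangeSeq.sameOrder_natCast {n : ℕ} {α : Fin n → ℝ} {ts : ℕ → ℝ} (h : IsChangeSeq α ts)
    {i t : ℕ} (hi : 0 ≤ ts i) (h1 : ⌊ts i⌋₊ ≤ t) (h2 : t < ⌊ts (i + 1)⌋₊) :
    SameOrder α (ts i) t := by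
  rcases lt_or_ge (ts i) t with hlt | hge
  · refine h.sameOrder hlt ?_
    rw [← h.floor_eq hi]
    exact_mod_cast h2
  · refine sameOrder_of_floor_eq α hi (Nat.cast_nonneg _) ?_
    rw [Nat.floor_natCast]
    exact le_antisymm h1 (Nat.le_floor hge)

lemma exists_mem_Ico_succ (N : ℕ → ℕ) {a b t : ℕ} (h1 : N a ≤ t) (h2 : t < N b) (hab : a ≤ b) :
    ∃ g, a ≤ g ∧ g < b ∧ N g ≤ t ∧ t < N (g + 1) := by
  induction b, hab using Nat.le_induction with
  | base => omega
  | succ b hab ih =>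
    rcases Nat.lt_or_ge t (N b) with h | h
    · obtain ⟨g, h3, h4, h5⟩ := ih h
      exact ⟨g, h3, by omega, h5⟩
    · exact ⟨b, hab, by omega, h, h2⟩

lemma IsChangeSeq.phases {n : ℕ} {α : Fin n → ℝ} {ts : ℕ → ℝ} (hirr : ∀ i, Irrational (α i))
    (hts : IsChangeSeq α ts) {T i : ℕ} (hT : 1 ≤ T) (hi : (T : ℝ) ≤ ts i)
    (hne : ∀ t : ℕ, T ≤ t → ∀ i j, i ≠ j → psi (α i) t ≠ psi (α j) t)
    (hcon : ∀ i j, i ≠ j → ∀ x y, T ≤ x → IsConsec (α i) x y → ¬ IsConsec (α j) x y)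
    (σ : ℕ → Fin n) :
    Phases (fun g p => psi (α (σ p)) (ts (i + g)))
      (fun e p => IsRecord (α (σ p)) ⌊ts (i + e + 1)⌋₊) := by
  have hmono : StrictMono ts := strictMono_nat_of_lt_succ hts.lt_succ
  have hge : ∀ g, (T : ℝ) ≤ ts (i + g) := fun g => hi.trans (hmono.monotone (by omega))
  have hnn : ∀ g, 0 ≤ ts (i + g) := fun g => (Nat.cast_nonneg T).trans (hge g)
  have hTN : ∀ g, T ≤ ⌊ts (i + g)⌋₊ := fun g => Nat.le_floor (hge g)
  have hN : ∀ g, ⌊ts (i + g)⌋₊ < ⌊ts (i + g + 1)⌋₊ := fun g => by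
    have h1 : (⌊ts (i + g)⌋₊ : ℝ) < ⌊ts (i + g + 1)⌋₊ := by
      rw [hts.floor_eq (hnn g)]
      exact (Nat.floor_le (hnn g)).trans_lt (hts.lt_succ _)
    exact_mod_cast h1
  have hNmono : StrictMono fun g => ⌊ts (i + g)⌋₊ := strictMono_nat_of_lt_succ hN
  have hphase : ∀ (a b : ℕ) (p q : Fin n), a ≤ b →
      (∀ g, a ≤ g → g < b → psi (α p) (ts (i + g)) < psi (α q) (ts (i + g))) →
      ∀ t : ℕ, ⌊ts (i + a)⌋₊ ≤ t → t < ⌊ts (i + b)⌋₊ → psi (α p) t < psi (α q) t := by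
    intro a b p q hab h t h1 h2
    obtain ⟨g, h3, h4, h5, h6⟩ := exists_mem_Ico_succ (fun g => ⌊ts (i + g)⌋₊) h1 h2 hab
    exact (hts.sameOrder_natCast (hnn g) h5 h6 p q).1 (h g h3 h4)
  refine ⟨fun e _ p _ q _ h1 h2 => ?_, fun e f hef _ k _ l _ hke hkf hlf h => ?_,
    fun e f hef _ j _ k _ l _ hje hjf hke hkf hlf h1 h2 => ?_⟩
  · have hlt := hN e
    obtain ⟨m, hm⟩ : ∃ m, ⌊ts (i + e + 1)⌋₊ = m + 1 := ⟨⌊ts (i + e + 1)⌋₊ - 1, by omega⟩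
    have hm1 : 1 ≤ m := by
      have := hTN e
      omega
    rw [hm]
    refine isRecord_of_psi_lt hm1 ?_
    have h3 : psi (α (σ q)) m < psi (α (σ p)) m :=
      (hts.sameOrder_natCast (hnn e) (by omega) (by omega) _ _).1 h1
    rw [← psi_floor (hnn (e + 1)), ← psi_floor (hnn (e + 1)), ← add_assoc, hm] at h2
    have h4 : psi (α (σ q)) (m + 1 : ℕ) ≤ psi (α (σ q)) m :=
      psi_anti (by exact_mod_cast hm1) (by push_cast; linarith)
    linarith
  · refine not_isRecord_of_forall_psi_lt (hirr _) (hirr _) (hNmono (show e + 1 < f + 1 by omega))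
      hke hkf (fun t ht1 ht2 => ?_) hlf
    exact hphase (e + 1) (f + 2) _ _ (by omega) (fun g hg1 hg2 => h g (by omega) (by omega)) t ht1
      (ht2.trans_lt (hN (f + 1)))
  · have hjk : σ j ≠ σ k := fun he => (h1 (e + 1) (by omega) (by omega)).ne (by simp only [he])
    have hkl : σ k ≠ σ l := fun he => (h2 (e + 1) (by omega) (by omega)).ne (by simp only [he])
    exact not_isRecord_of_chain (hirr _) (hirr _) (hirr _) (hne _ (hTN (f + 1)) _ _ hkl)
      (fun x y hx => hcon _ _ hjk x y ((hTN (e + 1)).trans hx))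
      (hNmono (show e + 1 < f + 1 by omega)) hje hjf hke hkf
      (hphase (e + 1) (f + 1) _ _ (by omega) fun g hg1 hg2 => h1 g (by omega) (by omega))
      (hphase (e + 1) (f + 1) _ _ (by omega) fun g hg1 hg2 => h2 g (by omega) (by omega)) hlf

lemma exists_forall_pairs {n : ℕ} {α : Fin n → ℝ} (hirr : ∀ i, Irrational (α i)) {T₀ : ℕ}
    (hne : ∀ t : ℕ, T₀ ≤ t → ∀ i j, i ≠ j → psi (α i) t ≠ psi (α j) t) :
    ∃ T : ℕ, ∀ i j, i ≠ j → ∀ x y, T ≤ x → IsConsec (α i) x y → ¬ IsConsec (α j) x y := by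
  have hex : ∀ p : Fin n × Fin n, ∃ T : ℕ, p.1 ≠ p.2 → ∀ x y, T ≤ x → IsConsec (α p.1) x y →
      ¬ IsConsec (α p.2) x y := by
    intro p
    by_cases h : p.1 = p.2
    · exact ⟨0, fun h' => absurd h h'⟩
    · obtain ⟨T, hT⟩ := exists_forall_not_isConsec (hirr p.1) (hirr p.2)
        fun t ht => hne t ht _ _ h
      exact ⟨T, fun _ => hT⟩
  choose T hT using hex
  obtain ⟨M, hM⟩ := Set.finite_range T |>.bddAbove
  exact ⟨M, fun i j hij x y hx => hT (i, j) hij x y ((hM ⟨(i, j), rfl⟩).trans hx)⟩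

/-- For six pairwise independent numbers with `k(α) = 3`, the pattern `a b a c`
(with `a, b, c` pairwise distinct order vectors) eventually never occurs. -/
theorem stmt16 (α : Fin 6 → ℝ) (hirr : ∀ i, Irrational (α i))
    (hind : PairwiseIndependent α) (hka : kAlpha α = 3) :
    ∃ T : ℝ, 1 < T ∧ ∀ t0 : ℝ, T ≤ t0 → ∀ ts : ℕ → ℝ, ts 0 = t0 → IsChangeSeq α ts →
      ∀ i : ℕ,
        ¬ (SameOrder α (ts i) (ts (i + 2)) ∧
           ¬ SameOrder α (ts i) (ts (i + 1)) ∧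
           ¬ SameOrder α (ts i) (ts (i + 3)) ∧
           ¬ SameOrder α (ts (i + 1)) (ts (i + 3))) := by
  obtain ⟨T₁, hT₁⟩ := exists_forall_sameOrder hind hka
  obtain ⟨T₀, -, hT₀⟩ := hind
  obtain ⟨T₂, hT₂⟩ := exists_forall_pairs hirr (T₀ := ⌈T₀⌉₊) fun t ht => hT₀ t (Nat.ceil_le.1 ht)
  obtain ⟨M, hM⟩ : ∃ M : ℕ, M = ⌈T₀⌉₊ + ⌈T₁⌉₊ + T₂ + 2 := ⟨_, rfl⟩
  have hMT₁ : T₁ < M := (Nat.le_ceil T₁).trans_lt (by exact_mod_cast (by omega))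
  have hMT₀ : T₀ ≤ M := (Nat.le_ceil T₀).trans (by exact_mod_cast (by omega))
  refine ⟨M, by exact_mod_cast (by omega), ?_⟩
  rintro t0 ht0 ts rfl hts i ⟨h02, h01, h03, h13⟩
  have hmono : StrictMono ts := strictMono_nat_of_lt_succ hts.lt_succ
  have hge : ∀ g, (M : ℝ) ≤ ts g := fun g => ht0.trans (hmono.monotone (Nat.zero_le g))
  have hnn : ∀ g, 0 ≤ ts g := fun g => (Nat.cast_nonneg M).trans (hge g)
  have hcase : ∀ t : ℝ, M ≤ t → SameOrder α (ts i) t ∨ SameOrder α (ts (i + 1)) t ∨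
      SameOrder α (ts (i + 3)) t := fun t ht =>
    hT₁ _ _ _ t (hMT₁.trans_le (hge _)) (hMT₁.trans_le (hge _)) (hMT₁.trans_le (hge _))
      (hMT₁.trans_le ht) h01 h03 h13
  have hne : ∀ t : ℝ, M ≤ t → ∀ i j, i ≠ j → psi (α i) t ≠ psi (α j) t := fun t ht =>
    hT₀ t (hMT₀.trans ht)
  obtain ⟨v, hv⟩ := exists_isOrderVec α (hne (ts i) (hge i))
  have hinj : ∀ p < 6, ∀ q < 6, p ≠ q → v (Fin.ofNat 6 p) ≠ v (Fin.ofNat 6 q) := by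
    intro p hp q hq hpq h
    have := congrArg Fin.val (hv.1.1 h)
    simp only [Fin.val_ofNat] at this
    omega
  have hP := hts.phases hirr (T := M) (i := i) (by omega) (hge i)
    (fun t ht => hne t (by exact_mod_cast ht)) (fun p q hpq x y hx => hT₂ p q hpq x y (by omega))
    fun p => v (Fin.ofNat 6 p)
  have hF0 : ∀ p < 6, ∀ q < 6, p < q →
      psi (α (v (Fin.ofNat 6 q))) (ts i) < psi (α (v (Fin.ofNat 6 p))) (ts i) := by
    intro p hp q hq hpq
    refine hv.2 _ _ (Fin.lt_def.2 ?_)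
    simp only [Fin.val_ofNat]
    omega
  obtain ⟨back, hback⟩ : ∃ back : Bool,
      SameOrder α (ts (i + if back then 0 else 1)) (ts (i + 4)) := by
    rcases hcase (ts (i + 4)) (hge _) with h | h | h
    · exact ⟨true, h⟩
    · exact ⟨false, h⟩
    · exact absurd h (hts (i + 3)).1.2
  refine hP.false back hF0 (fun p _ q _ => (h02 _ _).1) (fun p _ q _ => (hback _ _).1)
    (fun p hp q hq hpq => hne _ (hge _) _ _ (hinj p hp q hq hpq))
    (fun p hp q hq hpq => hne _ (hge _) _ _ (hinj p hp q hq hpq)) fun p hp q hq hpq => ?_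
  obtain ⟨t, ht, hlt⟩ := exists_psi_lt (hirr (v (Fin.ofNat 6 p))) (hirr (v (Fin.ofNat 6 q)))
    (T₀ := M) fun t ht => hne t (by exact_mod_cast ht) _ _ (hinj p hp q hq hpq.ne)
  rcases hcase t (by exact_mod_cast ht) with h | h | h
  · exact absurd ((h _ _).2 hlt) (hF0 p hp q hq hpq).not_gt
  · exact Or.inl ((h _ _).2 hlt)
  · exact Or.inr ((h _ _).2 hlt)
end

section
/- For every n ≥ 1, for Lebesgue-almost every α = (α_1, …, α_n) ∈ ℝⁿ, the tuple α is an n-tuple of pairwise independent irrational numbers and k(α) = n!. -/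
section

open MeasureTheory Metric Filter Topology

theorem bddBelow_distToInt_image (α t : ℝ) :
    BddBelow ((fun q : ℤ => distToInt ((q : ℝ) * α)) '' {q : ℤ | 1 ≤ q ∧ (q : ℝ) ≤ t}) :=
  ⟨0, by rintro _ ⟨q, -, rfl⟩; exact abs_nonneg _⟩

theorem psi_le_distToInt (α : ℝ) {t : ℝ} {q : ℤ} (h1 : 1 ≤ q) (ht : (q : ℝ) ≤ t) :
    psi α t ≤ distToInt ((q : ℝ) * α) :=
  csInf_le (bddBelow_distToInt_image α t) ⟨q, ⟨h1, ht⟩, rfl⟩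

theorem exists_psi_eq_distToInt (α : ℝ) {t : ℝ} (ht : 1 ≤ t) :
    ∃ q : ℤ, 1 ≤ q ∧ (q : ℝ) ≤ t ∧ psi α t = distToInt ((q : ℝ) * α) := by
  have hfin : {q : ℤ | 1 ≤ q ∧ (q : ℝ) ≤ t}.Finite :=
    (Set.finite_Icc (1 : ℤ) ⌊t⌋).subset fun q hq => ⟨hq.1, Int.le_floor.2 hq.2⟩
  have hne : {q : ℤ | 1 ≤ q ∧ (q : ℝ) ≤ t}.Nonempty := ⟨1, le_refl _, by simpa using ht⟩
  obtain ⟨q, hq, h⟩ := (hne.image fun q : ℤ => distToInt ((q : ℝ) * α)).csInf_mem (hfin.image _)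
  exact ⟨q, hq.1, hq.2, h.symm⟩

theorem psi_le_div_iff (α δ : ℝ) {N : ℕ} (hN : 0 < N) :
    psi α N ≤ δ / N ↔ ∃ ρ : ℚ, ρ.den ≤ N ∧ |α - ρ| ≤ δ / (N * ρ.den) := by
  have hN' : (0 : ℝ) < N := by exact_mod_cast hN
  constructor
  · intro h
    obtain ⟨q, hq1, hqN, hq⟩ := exists_psi_eq_distToInt α (t := N) (by exact_mod_cast hN)
    have hq0 : (0 : ℝ) < q := by exact_mod_cast hq1
    set p := round ((q : ℝ) * α) with hp
    have hdvd : ((((p : ℚ) / q).den : ℕ) : ℤ) ∣ q := by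
      rw [← Rat.divInt_eq_div]
      exact Rat.den_dvd p q
    have hle : ((((p : ℚ) / q).den : ℕ) : ℤ) ≤ q := Int.le_of_dvd (by omega) hdvd
    have hle' : (((p : ℚ) / q).den : ℝ) ≤ q := by exact_mod_cast hle
    have hden : (0 : ℝ) < (((p : ℚ) / q).den : ℝ) := by exact_mod_cast ((p : ℚ) / q).den_pos
    refine ⟨(p : ℚ) / q, by exact_mod_cast hle'.trans hqN, ?_⟩
    have h1 : |α - (((p : ℚ) / q : ℚ) : ℝ)| * q ≤ δ / N := by
      rw [hq, distToInt, ← hp] at h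
      calc |α - (((p : ℚ) / q : ℚ) : ℝ)| * q = |(α - (((p : ℚ) / q : ℚ) : ℝ)) * q| := by
            rw [abs_mul, abs_of_pos hq0]
        _ = |q * α - p| := by congr 1; push_cast; field_simp
        _ ≤ δ / N := h
    rw [← div_div, le_div_iff₀ hden]
    exact (mul_le_mul_of_nonneg_left hle' (abs_nonneg _)).trans h1
  · rintro ⟨ρ, hρN, hρ⟩
    have hden : (0 : ℝ) < ρ.den := by exact_mod_cast ρ.den_pos
    refine (psi_le_distToInt α (q := ρ.den) (by exact_mod_cast ρ.den_pos)
      (by exact_mod_cast hρN)).trans ((round_le _ ρ.num).trans ?_)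
    rw [← div_div, le_div_iff₀ hden] at hρ
    refine le_trans (le_of_eq ?_) hρ
    rw [← abs_of_pos hden, ← abs_mul, sub_mul, Rat.cast_def ρ,
      div_mul_cancel₀ _ hden.ne', mul_comm, Int.cast_natCast]

/-- The rationals of denominator at most `N` within distance `s` of `y`. -/
def fracsNear (N : ℕ) (y s : ℝ) : Set ℚ := {ρ | ρ.den ≤ N ∧ |(ρ : ℝ) - y| ≤ s}

theorem finite_fracsNear (N : ℕ) (y s : ℝ) : (fracsNear N y s).Finite := by
  refine ((Set.finite_Icc (-⌈(N : ℝ) * (|y| + s)⌉) ⌈(N : ℝ) * (|y| + s)⌉).image2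
    (fun (a : ℤ) (b : ℕ) => (a : ℚ) / b) (Set.finite_Iic N)).subset ?_
  rintro ρ ⟨hN, hs⟩
  refine ⟨ρ.num, ?_, ρ.den, hN, Rat.num_div_den ρ⟩
  have hden : (0 : ℝ) < ρ.den := by exact_mod_cast ρ.den_pos
  have hnum : (ρ.num : ℝ) = ρ.den * ρ := by
    rw [Rat.cast_def ρ]; field_simp
  have h2 : |(ρ : ℝ)| ≤ |y| + s := by
    have := abs_sub_abs_le_abs_sub (ρ : ℝ) y
    linarith
  have h1 : |(ρ.num : ℝ)| ≤ N * (|y| + s) := by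
    rw [hnum, abs_mul, abs_of_pos hden]
    exact mul_le_mul (by exact_mod_cast hN) h2 (abs_nonneg _) (Nat.cast_nonneg _)
  have h3 : |(ρ.num : ℝ)| ≤ ⌈(N : ℝ) * (|y| + s)⌉ := h1.trans (Int.le_ceil _)
  have h4 : |ρ.num| ≤ ⌈(N : ℝ) * (|y| + s)⌉ := by exact_mod_cast h3
  exact ⟨(abs_le.1 h4).1, (abs_le.1 h4).2⟩

/-- The sum of `1 / (N q)` over the reduced fractions `p / q` in `fracsNear N y s`. -/
noncomputable def fracsNearSum (N : ℕ) (y s : ℝ) : ℝ :=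
  ∑ ρ ∈ (finite_fracsNear N y s).toFinset, 1 / ((N : ℝ) * ρ.den)

theorem one_div_den_mul_den_le_abs_sub {ρ σ : ℚ} (h : ρ ≠ σ) :
    1 / ((ρ.den : ℝ) * σ.den) ≤ |(ρ : ℝ) - σ| := by
  have hρ : (0 : ℝ) < ρ.den := by exact_mod_cast ρ.den_pos
  have hσ : (0 : ℝ) < σ.den := by exact_mod_cast σ.den_pos
  have hz : ρ.num * σ.den - σ.num * ρ.den ≠ 0 := fun h0 =>
    h (Rat.eq_iff_mul_eq_mul.2 (sub_eq_zero.1 h0))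
  have h1 : (1 : ℝ) ≤ |(ρ.num : ℝ) * σ.den - σ.num * ρ.den| := by
    exact_mod_cast Int.one_le_abs hz
  rw [div_le_iff₀ (by positivity), ← abs_of_pos (mul_pos hρ hσ), ← abs_mul]
  refine h1.trans (le_of_eq (congrArg _ ?_))
  rw [Rat.cast_def ρ, Rat.cast_def σ]
  field_simp

theorem disjoint_ball_rat {N : ℕ} {δ : ℝ} (hδ' : δ ≤ 1 / 2) {ρ σ : ℚ} (h : ρ ≠ σ)
    (hρN : ρ.den ≤ N) (hσN : σ.den ≤ N) :
    Disjoint (ball (ρ : ℝ) (δ / (N * ρ.den))) (ball (σ : ℝ) (δ / (N * σ.den))) := by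
  apply ball_disjoint_ball
  have hρ : (0 : ℝ) < ρ.den := by exact_mod_cast ρ.den_pos
  have hσ : (0 : ℝ) < σ.den := by exact_mod_cast σ.den_pos
  have hρN' : (ρ.den : ℝ) ≤ N := by exact_mod_cast hρN
  have hσN' : (σ.den : ℝ) ≤ N := by exact_mod_cast hσN
  have hN : (0 : ℝ) < N := hρ.trans_le hρN'
  rw [Real.dist_eq]
  refine le_trans ?_ (one_div_den_mul_den_le_abs_sub h)
  rw [div_add_div _ _ (by positivity) (by positivity), div_le_div_iff₀ (by positivity) (by positivity)]
  have h1 : δ * (σ.den + ρ.den) ≤ N := by nlinarith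
  have h2 := mul_le_mul_of_nonneg_left h1 (by positivity : (0 : ℝ) ≤ N * (ρ.den * σ.den))
  linarith

theorem volume_iUnion_ball_fracsNear {N : ℕ} {δ : ℝ} (hδ : 0 ≤ δ) (hδ' : δ ≤ 1 / 2) (y s : ℝ) :
    volume (⋃ ρ ∈ (finite_fracsNear N y s).toFinset, ball (ρ : ℝ) (δ / (N * ρ.den))) =
      ENNReal.ofReal (2 * δ * fracsNearSum N y s) := by
  rw [measure_biUnion_finset]
  · rw [fracsNearSum, Finset.mul_sum, ENNReal.ofReal_sum_of_nonneg (fun _ _ => by positivity)]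
    refine Finset.sum_congr rfl fun ρ _ => ?_
    rw [Real.volume_ball]
    congr 1
    ring
  · intro ρ hρ σ hσ h
    simp only [Set.Finite.coe_toFinset] at hρ hσ
    exact disjoint_ball_rat hδ' h hρ.1 hσ.1
  · exact fun _ _ => measurableSet_ball

theorem volume_iUnion_closedBall_fracsNear_le {N : ℕ} {δ : ℝ} (hδ : 0 ≤ δ) (y s : ℝ) :
    volume (⋃ ρ ∈ (finite_fracsNear N y s).toFinset, closedBall (ρ : ℝ) (δ / (N * ρ.den))) ≤
      ENNReal.ofReal (2 * δ * fracsNearSum N y s) := by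
  refine (measure_biUnion_finset_le _ _).trans (le_of_eq ?_)
  rw [fracsNearSum, Finset.mul_sum, ENNReal.ofReal_sum_of_nonneg (fun _ _ => by positivity)]
  refine Finset.sum_congr rfl fun ρ _ => ?_
  rw [Real.volume_closedBall]
  congr 1
  ring

theorem div_natCast_mul_den_le {δ : ℝ} (hδ : 0 ≤ δ) (N : ℕ) (ρ : ℚ) :
    δ / (N * ρ.den) ≤ δ / N := by
  rw [← div_div]
  exact div_le_self (by positivity) (by exact_mod_cast ρ.den_pos)

theorem fracsNearSum_le (N : ℕ) (y : ℝ) {s : ℝ} (hs : 0 ≤ s) :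
    fracsNearSum N y s ≤ 2 * s + 1 / N := by
  have h : ENNReal.ofReal (2 * (1 / 2) * fracsNearSum N y s) ≤
      ENNReal.ofReal (2 * (s + 1 / 2 / N)) := by
    rw [← volume_iUnion_ball_fracsNear (by norm_num) le_rfl, ← Real.volume_ball y]
    refine measure_mono (Set.iUnion₂_subset fun ρ hρ => ball_subset_ball' ?_)
    have hρ := ((finite_fracsNear N y s).mem_toFinset.1 hρ).2
    rw [Real.dist_eq, add_comm]
    exact add_le_add hρ (div_natCast_mul_den_le (by norm_num) N ρ)
  rw [ENNReal.ofReal_le_ofReal_iff (by positivity)] at h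
  calc _ = _ := by ring
    _ ≤ _ := h
    _ = _ := by ring

theorem le_fracsNearSum {N : ℕ} (hN : 0 < N) (y s : ℝ) : s - 1 / N ≤ fracsNearSum N y s := by
  have hnn : 0 ≤ fracsNearSum N y s := Finset.sum_nonneg fun _ _ => by positivity
  have h : ENNReal.ofReal (2 * (s - 1 / N)) ≤ ENNReal.ofReal (2 * 1 * fracsNearSum N y s) := by
    refine le_trans ?_ (volume_iUnion_closedBall_fracsNear_le zero_le_one y s)
    rw [← Real.volume_closedBall y]
    refine measure_mono fun α hα => ?_
    obtain ⟨ρ, hρ, hρN⟩ := Real.exists_rat_abs_sub_le_and_den_le α hN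
    have hden : (0 : ℝ) < ρ.den := by exact_mod_cast ρ.den_pos
    have hN' : (0 : ℝ) < N := by exact_mod_cast hN
    have hρ' : |α - ρ| ≤ 1 / (N * ρ.den) :=
      hρ.trans (one_div_le_one_div_of_le (by positivity) (by gcongr; linarith))
    refine Set.mem_iUnion₂.2 ⟨ρ, (finite_fracsNear N y s).mem_toFinset.2 ⟨hρN, ?_⟩, hρ'⟩
    rw [mem_closedBall, Real.dist_eq] at hα
    have h1 := abs_sub_le (ρ : ℝ) α y
    rw [abs_sub_comm (ρ : ℝ) α] at h1
    have h2 := div_natCast_mul_den_le zero_le_one N ρ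
    linarith
  rw [ENNReal.ofReal_le_ofReal_iff (by positivity)] at h
  linarith

theorem le_volume_psi_le {N : ℕ} (hN : 0 < N) {δ : ℝ} (hδ : 0 ≤ δ) (hδ' : δ ≤ 1 / 2) (y r : ℝ) :
    ENNReal.ofReal (2 * δ * (r - 2 / N)) ≤
      volume ({α | psi α N ≤ δ / N} ∩ closedBall y r) := by
  have hN' : (0 : ℝ) < N := by exact_mod_cast hN
  calc ENNReal.ofReal (2 * δ * (r - 2 / N))
      ≤ ENNReal.ofReal (2 * δ * fracsNearSum N y (r - 1 / N)) := by
        refine ENNReal.ofReal_le_ofReal (mul_le_mul_of_nonneg_left ?_ (by positivity))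
        refine le_trans (le_of_eq ?_) (le_fracsNearSum hN y _)
        ring
    _ = _ := (volume_iUnion_ball_fracsNear hδ hδ' y _).symm
    _ ≤ _ := by
        refine measure_mono (Set.iUnion₂_subset fun ρ hρ α hα => ?_)
        obtain ⟨hρN, hρ⟩ := (finite_fracsNear N y _).mem_toFinset.1 hρ
        rw [mem_ball, Real.dist_eq] at hα
        refine ⟨(psi_le_div_iff α δ hN).2 ⟨ρ, hρN, hα.le⟩, ?_⟩
        rw [mem_closedBall, Real.dist_eq]
        have h1 := abs_sub_le α (ρ : ℝ) y
        have h2 := div_natCast_mul_den_le hδ N ρ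
        have h3 : δ / N ≤ 1 / N := by gcongr; linarith
        linarith

theorem volume_psi_le_le {N : ℕ} (hN : 0 < N) {δ : ℝ} (hδ : 0 ≤ δ) (hδ' : δ ≤ 1 / 2) (y : ℝ)
    {r : ℝ} (hr : 0 ≤ r) :
    volume ({α | psi α N ≤ δ / N} ∩ closedBall y r) ≤
      ENNReal.ofReal (2 * δ * (2 * r + 3 / N)) := by
  have hN' : (0 : ℝ) < N := by exact_mod_cast hN
  calc volume ({α | psi α N ≤ δ / N} ∩ closedBall y r)
      ≤ volume (⋃ ρ ∈ (finite_fracsNear N y (r + 1 / N)).toFinset,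
          closedBall (ρ : ℝ) (δ / (N * ρ.den))) := by
        refine measure_mono ?_
        rintro α ⟨hα, hαy⟩
        obtain ⟨ρ, hρN, hρ⟩ := (psi_le_div_iff α δ hN).1 hα
        refine Set.mem_iUnion₂.2 ⟨ρ, (finite_fracsNear N y _).mem_toFinset.2 ⟨hρN, ?_⟩, hρ⟩
        rw [mem_closedBall, Real.dist_eq] at hαy
        have h1 := abs_sub_le (ρ : ℝ) α y
        rw [abs_sub_comm (ρ : ℝ) α] at h1
        have h2 := div_natCast_mul_den_le hδ N ρ
        have h3 : δ / N ≤ 1 / N := by gcongr; linarith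
        linarith
    _ ≤ ENNReal.ofReal (2 * δ * fracsNearSum N y (r + 1 / N)) :=
        volume_iUnion_closedBall_fracsNear_le hδ y _
    _ ≤ _ := by
        refine ENNReal.ofReal_le_ofReal (mul_le_mul_of_nonneg_left ?_ (by positivity))
        refine (fracsNearSum_le N y (by positivity)).trans (le_of_eq ?_)
        ring

theorem le_volume_psi_mem_Ioc {N : ℕ} {r : ℝ} (hr : 0 < r) (hN : 4 ≤ r * N) {δ : ℝ}
    (hδ : 0 ≤ δ) (hδ' : δ ≤ 1 / 2) (y : ℝ) :
    ENNReal.ofReal (δ * r / 2 - δ * r / 24) ≤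
      volume ({α | psi α N ∈ Set.Ioc (δ / 12 / N) (δ / N)} ∩ closedBall y r) := by
  have hN' : (0 : ℝ) < N := by
    by_contra h
    nlinarith
  have hN0 : 0 < N := by exact_mod_cast hN'
  have hrN : 1 / N ≤ r / 4 := by
    rw [div_le_div_iff₀ hN' (by norm_num)]
    linarith
  have h1 := le_volume_psi_le hN0 hδ hδ' y r
  have h2 := volume_psi_le_le hN0 (δ := δ / 12) (by positivity) (by linarith) y hr.le
  have hset : {α | psi α N ∈ Set.Ioc (δ / 12 / N) (δ / N)} ∩ closedBall y r =
      ({α | psi α N ≤ δ / N} ∩ closedBall y r) \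
        ({α | psi α N ≤ δ / 12 / N} ∩ closedBall y r) := by
    ext α
    simp only [Set.mem_inter_iff, Set.mem_ofPred_eq, Set.mem_Ioc, Set.mem_sdiff, ← not_le]
    tauto
  rw [hset]
  refine le_trans ?_ le_measure_sdiff
  refine le_trans ?_ (tsub_le_tsub h1 h2)
  rw [← ENNReal.ofReal_sub _ (by positivity)]
  apply ENNReal.ofReal_le_ofReal
  have e2 : (2 : ℝ) / N = 2 * (1 / N) := by ring
  have e3 : (3 : ℝ) / N = 3 * (1 / N) := by ring
  rw [e2, e3]
  nlinarith [mul_le_mul_of_nonneg_left hrN hδ]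

theorem measurable_psi (t : ℝ) : Measurable fun α => psi α t := by
  have h : (fun α => psi α t) = fun α => ⨅ q : {q : ℤ | 1 ≤ q ∧ (q : ℝ) ≤ t},
      distToInt (((q : ℤ) : ℝ) * α) := by
    ext α
    exact sInf_image'
  rw [h]
  refine Measurable.iInf fun q => ?_
  simp only [distToInt, round_eq]
  fun_prop

theorem measurableSet_psi_lt {n : ℕ} (v : Fin n → Fin n) (t : ℝ) :
    MeasurableSet {α : Fin n → ℝ | ∀ p q : Fin n, p < q → psi (α (v p)) t > psi (α (v q)) t} := by
  have h (i : Fin n) : Measurable fun α : Fin n → ℝ => psi (α i) t :=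
    (measurable_psi t).comp (measurable_pi_apply i)
  simp only [Set.ofPred_forall]
  exact .iInter fun p => .iInter fun q => .iInter fun _ => measurableSet_lt (h _) (h _)

/-- The proportion of a large cube on which a prescribed order is guaranteed. -/
noncomputable def orderDensity (n : ℕ) : ℝ := ∏ i : Fin n, (1 / 2 / 12 ^ (i : ℕ) : ℝ) / 8

theorem orderDensity_pos (n : ℕ) : 0 < orderDensity n :=
  Finset.prod_pos fun _ _ => by positivity

theorem orderDensity_mul_volume_le {n N : ℕ} (σ : Equiv.Perm (Fin n)) (x : Fin n → ℝ) {r : ℝ}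
    (hr : 0 < r) (hN : 4 ≤ r * N) :
    ENNReal.ofReal (orderDensity n) * volume (closedBall x r) ≤
      volume ({α : Fin n → ℝ | ∀ p q : Fin n, p < q → psi (α (σ p)) N > psi (α (σ q)) N} ∩
        closedBall x r) := by
  let δ : ℕ → ℝ := fun k => 1 / 2 / 12 ^ k
  have hδpos (k : ℕ) : 0 < δ k := by positivity
  have hδanti : Antitone δ := fun a b hab => by
    simp only [δ]
    gcongr
    norm_num
  have hδsucc (k : ℕ) : δ (k + 1) = δ k / 12 := by simp only [δ]; rw [pow_succ]; field_simp
  have hδle (k : ℕ) : δ k ≤ 1 / 2 := by simpa [δ] using hδanti (Nat.zero_le k)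
  let G : Fin n → Set ℝ := fun i =>
    {a | psi a N ∈ Set.Ioc (δ (σ.symm i) / 12 / N) (δ (σ.symm i) / N)} ∩ closedBall (x i) r
  have hsub : Set.univ.pi G ⊆
      {α : Fin n → ℝ | ∀ p q : Fin n, p < q → psi (α (σ p)) N > psi (α (σ q)) N} ∩
        closedBall x r := by
    intro α hα
    refine ⟨fun p q hpq => ?_, ?_⟩
    · have hp := (hα (σ p) trivial).1.1
      have hq := (hα (σ q) trivial).1.2
      rw [σ.symm_apply_apply] at hp hq
      rw [← hδsucc] at hp
      have hle : δ q / N ≤ δ (p + 1) / N :=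
        div_le_div_of_nonneg_right (hδanti hpq) (Nat.cast_nonneg N)
      exact (hq.trans hle).trans_lt hp
    · rw [closedBall_pi _ hr.le]
      exact fun i _ => (hα i trivial).2
  refine le_trans ?_ (measure_mono hsub)
  rw [closedBall_pi _ hr.le, volume_pi_pi, volume_pi_pi]
  simp only [Real.volume_closedBall]
  rw [orderDensity, ENNReal.ofReal_prod_of_nonneg fun i _ => by positivity,
    ← Equiv.prod_comp σ.symm fun i => ENNReal.ofReal ((1 / 2 / 12 ^ (i : ℕ) : ℝ) / 8),
    ← Finset.prod_mul_distrib]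
  refine Finset.prod_le_prod' fun i _ => ?_
  refine le_trans ?_ (le_volume_psi_mem_Ioc hr hN (hδpos _).le (hδle _) (x i))
  rw [← ENNReal.ofReal_mul (by positivity)]
  apply ENNReal.ofReal_le_ofReal
  have := mul_pos (hδpos (σ.symm i)) hr
  simp only [δ] at this ⊢
  linarith

/-- A measurable set occupying at least a fixed positive proportion of every ball
has full measure. -/
theorem ae_mem_of_forall_mul_volume_closedBall_le {n : ℕ} {E : Set (Fin n → ℝ)}
    (hE : MeasurableSet E) {c : ENNReal} (hc : c ≠ 0)
    (h : ∀ x : Fin n → ℝ, ∀ r : ℝ, 0 < r →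
      c * volume (closedBall x r) ≤ volume (E ∩ closedBall x r)) :
    ∀ᵐ x : Fin n → ℝ ∂volume, x ∈ E := by
  have hdens := IsUnifLocDoublingMeasure.ae_tendsto_measure_inter_div
    (volume : Measure (Fin n → ℝ)) Eᶜ 1
  rw [ae_restrict_iff' hE.compl] at hdens
  filter_upwards [hdens] with x hx
  by_contra hxE
  have hlim := hx hxE (l := 𝓝[>] (0 : ℝ)) (fun _ => x) id tendsto_id (by
    filter_upwards [self_mem_nhdsWithin] with r hr
    have hr : (0 : ℝ) < r := hr
    simp [hr.le])
  have hle : ∀ᶠ r in 𝓝[>] (0 : ℝ),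
      volume (Eᶜ ∩ closedBall x (id r)) / volume (closedBall x (id r)) ≤ 1 - c := by
    filter_upwards [self_mem_nhdsWithin] with r hr
    have hr : (0 : ℝ) < r := hr
    have h0 : volume (closedBall x r) ≠ 0 := (measure_closedBall_pos volume x hr).ne'
    have htop : volume (closedBall x r) ≠ ⊤ := measure_closedBall_lt_top.ne
    rw [id, ENNReal.div_le_iff h0 htop, ENNReal.sub_mul fun _ _ => htop, one_mul]
    have hsum := measure_inter_add_sdiff (μ := volume) (closedBall x r) hE
    have hfin : volume (E ∩ closedBall x r) ≠ ⊤ := measure_ne_top_of_subset Set.inter_subset_right htop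
    have heq : volume (Eᶜ ∩ closedBall x r) =
        volume (closedBall x r) - volume (E ∩ closedBall x r) := by
      refine ENNReal.eq_sub_of_add_eq hfin ?_
      rw [← hsum, Set.inter_comm (closedBall x r) E, add_comm, Set.sdiff_eq, Set.inter_comm Eᶜ]
    rw [heq]
    exact tsub_le_tsub_left (h x r hr) _
  have hone : (1 : ENNReal) ≤ 1 - c := le_of_tendsto hlim hle
  exact absurd hone (not_le.2 (ENNReal.sub_lt_self ENNReal.one_ne_top one_ne_zero hc))

theorem ae_exists_isOrderVec {n : ℕ} (σ : Equiv.Perm (Fin n)) (T : ℕ) :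
    ∀ᵐ α : Fin n → ℝ ∂volume, ∃ N : ℕ, T < N ∧ IsOrderVec α N σ := by
  have hmeas : MeasurableSet (⋃ N : ℕ, ⋃ _ : T < N,
      {α : Fin n → ℝ | ∀ p q : Fin n, p < q → psi (α (σ p)) N > psi (α (σ q)) N}) :=
    .iUnion fun N => .iUnion fun _ => measurableSet_psi_lt σ N
  have h := ae_mem_of_forall_mul_volume_closedBall_le hmeas
    (ENNReal.ofReal_pos.2 (orderDensity_pos n)).ne' fun x r hr => by
      obtain ⟨N, hN⟩ := exists_nat_gt (max (T : ℝ) (4 / r))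
      rw [max_lt_iff] at hN
      refine (orderDensity_mul_volume_le σ x hr (N := N) ?_).trans
        (measure_mono (Set.inter_subset_inter_left _ ?_))
      · rw [div_lt_iff₀ hr] at hN
        linarith [hN.2]
      · exact Set.subset_iUnion₂_of_subset N (by exact_mod_cast hN.1) subset_rfl
  filter_upwards [h] with α hα
  obtain ⟨N, hN, hα⟩ := Set.mem_iUnion₂.1 hα
  exact ⟨N, hN, σ.bijective, hα⟩

theorem ae_linearMap_apply_ne {n : ℕ} {L : (Fin n → ℝ) →ₗ[ℝ] ℝ} (hL : L ≠ 0) (c : ℝ) :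
    ∀ᵐ α : Fin n → ℝ ∂volume, L α ≠ c := by
  let s : AffineSubspace ℝ (Fin n → ℝ) :=
    { carrier := {α | L α = c}
      smul_vsub_vadd_mem' := by
        intro t a b d ha hb hd
        simp only [Set.mem_ofPred_eq] at ha hb hd
        simp [ha, hb, hd] }
  have hs : s ≠ ⊤ := by
    intro h
    refine hL (LinearMap.ext fun a => ?_)
    have ha : a ∈ s := h ▸ AffineSubspace.mem_top ℝ _ a
    have h0 : (0 : Fin n → ℝ) ∈ s := h ▸ AffineSubspace.mem_top ℝ _ 0
    have ha : L a = c := ha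
    have h0 : L 0 = c := h0
    rw [ha, ← h0, map_zero, LinearMap.zero_apply]
  have h := Measure.addHaar_affineSubspace (volume : Measure (Fin n → ℝ)) s hs
  rw [ae_iff]
  simp only [ne_eq, not_not]
  exact h

theorem ae_irrational {n : ℕ} (i : Fin n) : ∀ᵐ α : Fin n → ℝ ∂volume, Irrational (α i) := by
  have hL : (LinearMap.proj i : (Fin n → ℝ) →ₗ[ℝ] ℝ) ≠ 0 := fun h => by
    simpa using LinearMap.congr_fun h (Pi.single i 1)
  filter_upwards [ae_all_iff.2 fun ρ : ℚ => ae_linearMap_apply_ne hL ρ] with α hα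
  rintro ⟨ρ, hρ⟩
  exact hα ρ hρ.symm

theorem ae_integer_combination_ne {n : ℕ} {i j : Fin n} (hij : i ≠ j) {a : ℤ} (ha : a ≠ 0)
    (b c : ℤ) : ∀ᵐ α : Fin n → ℝ ∂volume, (a : ℝ) * α i + b * α j ≠ c := by
  have hL : ((a : ℝ) • LinearMap.proj i + (b : ℝ) • LinearMap.proj j :
      (Fin n → ℝ) →ₗ[ℝ] ℝ) ≠ 0 := fun h => by
    have := LinearMap.congr_fun h (Pi.single i 1)
    simp [hij.symm, ha] at this
  filter_upwards [ae_linearMap_apply_ne hL c] with α hα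
  simpa using hα

theorem ae_pairwiseIndependent (n : ℕ) : ∀ᵐ α : Fin n → ℝ ∂volume, PairwiseIndependent α := by
  have h : ∀ᵐ α : Fin n → ℝ ∂volume, ∀ i j : Fin n, i ≠ j → ∀ a : ℤ, a ≠ 0 → ∀ b c : ℤ,
      (a : ℝ) * α i + b * α j ≠ c := by
    simp only [ae_all_iff]
    exact fun i j hij a ha b c => ae_integer_combination_ne hij ha b c
  filter_upwards [h] with α hα
  refine ⟨1, zero_le_one, fun t ht i j hij heq => ?_⟩
  obtain ⟨a, ha, -, hai⟩ := exists_psi_eq_distToInt (α i) ht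
  obtain ⟨b, -, -, hbj⟩ := exists_psi_eq_distToInt (α j) ht
  rw [hai, hbj, distToInt, distToInt, abs_eq_abs] at heq
  rcases heq with heq | heq
  · refine hα i j hij a (by omega) (-b) (round (a * α i) - round (b * α j)) ?_
    push_cast
    linarith
  · refine hα i j hij a (by omega) b (round (a * α i) + round (b * α j)) ?_
    push_cast
    linarith

theorem ae_occursInfinitely (n : ℕ) :
    ∀ᵐ α : Fin n → ℝ ∂volume, ∀ σ : Equiv.Perm (Fin n), OccursInfinitely α σ := by
  filter_upwards [ae_all_iff.2 fun σ => ae_all_iff.2 fun T => ae_exists_isOrderVec (n := n) σ T]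
    with α hα σ T
  obtain ⟨K, hK⟩ := exists_nat_gt T
  obtain ⟨N, hN, h⟩ := hα σ K
  exact ⟨N, hK.trans (by exact_mod_cast hN), h⟩

theorem kAlpha_eq_factorial {n : ℕ} {α : Fin n → ℝ}
    (h : ∀ σ : Equiv.Perm (Fin n), OccursInfinitely α σ) : kAlpha α = n.factorial := by
  have hset : {v : Fin n → Fin n | OccursInfinitely α v} =
      Set.range fun σ : Equiv.Perm (Fin n) => (σ : Fin n → Fin n) := by
    ext v
    constructor
    · intro hv
      obtain ⟨t, -, ht⟩ := hv 0
      exact ⟨Equiv.ofBijective v ht.1, rfl⟩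
    · rintro ⟨σ, rfl⟩
      exact h σ
  rw [kAlpha, hset, Nat.card_range_of_injective DFunLike.coe_injective, Nat.card_perm,
    Nat.card_fin]

end

open MeasureTheory in
/-- For almost all `α ∈ ℝⁿ` (Lebesgue measure), the tuple `α` consists of pairwise
independent irrational numbers and `k(α) = n!`. -/
theorem stmt17 (n : ℕ) (hn : 1 ≤ n) :
    ∀ᵐ α : Fin n → ℝ ∂volume,
      (∀ i, Irrational (α i)) ∧ PairwiseIndependent α ∧ kAlpha α = Nat.factorial n := by
  filter_upwards [ae_all_iff.2 fun i => ae_irrational (n := n) i, ae_pairwiseIndependent n,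
    ae_occursInfinitely n] with α hirr hind hocc
  exact ⟨hirr, hind, kAlpha_eq_factorial hocc⟩
end
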